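/- arXiv:2306.07253 — 4 statements merged into one kernel-verified Lean document; each statement's English description precedes it below -/
import Mathlib

section
/- Let k = k(n) be a tame sequence of complete a-bounded colouring profiles. Then there is a function u* = u*(n) with u* ~ α ~ 2 log_b n such that k_u = 0 for all u < u*, and for every fixed s ∈ ℕ one has Σ_{u*≤u≤a} (α−u)^s · κ_u = O(1). -/
open Filter
open scoped BigOperators Classical

noncomputable section

/-- The number of edges of a simple graph on `Fin n`. -/
def edgeCount {n : ℕ} (G : SimpleGraph (Fin n)) : ℕ := Nat.card G.edgeSet

/-- Probability of a graph property under the uniform random graph `G(n,m)`. -/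
def Pm (n m : ℕ) (E : SimpleGraph (Fin n) → Prop) : ℝ :=
  (Nat.card {G : SimpleGraph (Fin n) // edgeCount G = m ∧ E G} : ℝ) /
    (Nat.card {G : SimpleGraph (Fin n) // edgeCount G = m} : ℝ)

/-- Expectation of a real functional under the uniform random graph `G(n,m)`. -/
def Em (n m : ℕ) (X : SimpleGraph (Fin n) → ℝ) : ℝ :=
  (∑ᶠ G : {G : SimpleGraph (Fin n) // edgeCount G = m}, X G.1) /
    (Nat.card {G : SimpleGraph (Fin n) // edgeCount G = m} : ℝ)

/-- Probability of a graph property under the binomial random graph `G(n,p)`. -/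
def Pp (n : ℕ) (p : ℝ) (E : SimpleGraph (Fin n) → Prop) : ℝ :=
  ∑ᶠ G : SimpleGraph (Fin n),
    (if E G then (1 : ℝ) else 0) * p ^ edgeCount G * (1 - p) ^ (n.choose 2 - edgeCount G)

/-- Expectation of a real functional under the binomial random graph `G(n,p)`. -/
def Ep (n : ℕ) (p : ℝ) (X : SimpleGraph (Fin n) → ℝ) : ℝ :=
  ∑ᶠ G : SimpleGraph (Fin n),
    X G * p ^ edgeCount G * (1 - p) ^ (n.choose 2 - edgeCount G)

/-- `α₀(n) = 2 log_b n − 2 log_b log_b n + 2 log_b (e/2) + 1`. -/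
def alpha0 (b : ℝ) (n : ℕ) : ℝ :=
  2 * Real.logb b n - 2 * Real.logb b (Real.logb b n) + 2 * Real.logb b (Real.exp 1 / 2) + 1

/-- `α(n) = ⌊α₀(n)⌋`. -/
def alphaNat (b : ℝ) (n : ℕ) : ℕ := ⌊alpha0 b n⌋₊

/-- `μ_t = C(n,t) q^{C(t,2)}`, the expected number of independent `t`-sets. -/
def muExp (q : ℝ) (n t : ℕ) : ℝ := (n.choose t : ℝ) * q ^ t.choose 2

/-- A finset of vertices is independent in `G`. -/
def IndepFinset {n : ℕ} (G : SimpleGraph (Fin n)) (s : Finset (Fin n)) : Prop :=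
  ∀ v ∈ s, ∀ w ∈ s, ¬ G.Adj v w

/-- `G` has a proper colouring with `k` colours, all colour classes of size at most `t`. -/
def HasBoundedColouring {n : ℕ} (G : SimpleGraph (Fin n)) (t k : ℕ) : Prop :=
  ∃ C : Fin n → Fin k, (∀ v w, G.Adj v w → C v ≠ C w) ∧
    ∀ c : Fin k, (Finset.univ.filter fun v => C v = c).card ≤ t

/-- The `t`-bounded chromatic number `χ_t(G)`. -/
def chiBounded {n : ℕ} (G : SimpleGraph (Fin n)) (t : ℕ) : ℕ :=
  sInf {k | HasBoundedColouring G t k}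

/-- `G` has an equitable proper colouring with `k` colours. -/
def HasEquitableColouring {n : ℕ} (G : SimpleGraph (Fin n)) (k : ℕ) : Prop :=
  ∃ C : Fin n → Fin k, (∀ v w, G.Adj v w → C v ≠ C w) ∧
    ∀ c c' : Fin k,
      (Finset.univ.filter fun v => C v = c).card ≤
        (Finset.univ.filter fun v => C v = c').card + 1

/-- The equitable chromatic number `χ₌(G)`. -/
def chiEquitable {n : ℕ} (G : SimpleGraph (Fin n)) : ℕ :=
  sInf {k | HasEquitableColouring G k}

/-- The number of unordered `t`-bounded proper `k`-colourings of `G`, i.e. partitions of the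
vertex set into exactly `k` nonempty independent sets, each of size at most `t`. -/
def numUnorderedColourings (n t k : ℕ) (G : SimpleGraph (Fin n)) : ℕ :=
  Set.ncard {Q : Finset (Finset (Fin n)) | Q.card = k ∧
    (∀ s ∈ Q, s.Nonempty ∧ s.card ≤ t ∧ IndepFinset G s) ∧
    (∀ v : Fin n, ∃ s ∈ Q, v ∈ s) ∧
    ∀ s ∈ Q, ∀ s' ∈ Q, s ≠ s' → Disjoint s s'}

/-- `E_{n,k,t}`: the expected number of unordered `t`-bounded `k`-colourings of `G_{n,1/2}`. -/
def Enkt (n k t : ℕ) : ℝ := Ep n (1/2) fun G => (numUnorderedColourings n t k G : ℝ)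

/-- The `t`-bounded first moment threshold `k_t(n)`. -/
def fmThreshold (n t : ℕ) : ℕ := sInf {k | 1 ≤ Enkt n k t}

/-- `P` is a (possibly partial) `k`-colouring profile on `n` vertices. -/
def IsProfile (n k : ℕ) (P : ℕ → ℕ) : Prop :=
  (∀ u, u ∉ Finset.Icc 1 n → P u = 0) ∧
    (∑ u ∈ Finset.Icc 1 n, P u = k) ∧ (∑ u ∈ Finset.Icc 1 n, u * P u ≤ n)

/-- A colouring profile is complete if its classes use all `n` vertices. -/
def IsCompleteProfile (n : ℕ) (P : ℕ → ℕ) : Prop :=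
  ∑ u ∈ Finset.Icc 1 n, u * P u = n

/-- A colouring profile is `t`-bounded if it has no classes of size larger than `t`. -/
def IsBoundedProfile (t : ℕ) (P : ℕ → ℕ) : Prop := ∀ u, t < u → P u = 0

/-- The number of parts of a profile on `n` vertices. -/
def profileParts (n : ℕ) (P : ℕ → ℕ) : ℕ := ∑ u ∈ Finset.Icc 1 n, P u

/-- `X_k`: the number of ordered (partial) proper colourings of `G` with profile `P`:
ordered tuples of pairwise disjoint independent sets, decreasing in size, with exactly
`P u` parts of size `u` for every `u`. -/
def Xprofile {n : ℕ} (G : SimpleGraph (Fin n)) (P : ℕ → ℕ) : ℕ :=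
  Set.ncard {V : Fin (profileParts n P) → Finset (Fin n) |
    (∀ i j, i ≠ j → Disjoint (V i) (V j)) ∧
    (∀ i j, i ≤ j → (V j).card ≤ (V i).card) ∧
    (∀ u : ℕ, (Finset.univ.filter fun i => (V i).card = u).card = P u) ∧
    ∀ i, IndepFinset G (V i)}

/-- `X̄_k = X_k / ∏_u k_u!`: the number of unordered colourings with profile `P`. -/
def Xbar {n : ℕ} (G : SimpleGraph (Fin n)) (P : ℕ → ℕ) : ℝ :=
  (Xprofile G P : ℝ) / ∏ u ∈ Finset.Icc 1 n, ((P u).factorial : ℝ)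

/-- `κ = Σ_u κ_u` where `κ_u = u k_u / n`. -/
def kappaTot (n : ℕ) (P : ℕ → ℕ) : ℝ := ∑ u ∈ Finset.Icc 1 n, (u : ℝ) * P u / n

/-- `m = ⌊p N⌋` with `N = C(n,2)`. -/
def mFloor (p : ℝ) (n : ℕ) : ℕ := ⌊p * (n.choose 2 : ℝ)⌋₊

/-- Definition 2.2: a sequence `P` of complete `a`-bounded colouring profiles is tame. -/
def IsTame (p : ℝ) (a : ℕ → ℕ) (P : ℕ → ℕ → ℕ) : Prop :=
  (∃ C : ℝ, ∀ᶠ n in atTop, alpha0 (1/(1-p)) n - C ≤ (a n : ℝ)) ∧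
  (∀ᶠ n in atTop, a n ≤ alphaNat (1/(1-p)) n) ∧
  (∀ n, IsProfile n (profileParts n (P n)) (P n) ∧ IsCompleteProfile n (P n) ∧
      IsBoundedProfile (a n) (P n)) ∧
  ∃ c : ℝ, c ∈ Set.Ioo (0:ℝ) 1 ∧ ∃ γ : ℕ → ℝ, Monotone γ ∧ Tendsto γ atTop atTop ∧
    (∀ᶠ n in atTop, ∀ u, 1 ≤ u → u ≤ a n →
      (u : ℝ) * P n u / n <
        (1/(1-p)) ^ (-(((alphaNat (1/(1-p)) n - u : ℕ) : ℝ) *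
          γ (alphaNat (1/(1-p)) n - u)))) ∧
    ∀ ε : ℝ, 0 < ε → ∀ᶠ n : ℕ in atTop,
      Real.exp (-ε * (n : ℝ) ^ ((1:ℝ) - c)) ≤ Em n (mFloor p n) fun G => Xbar G (P n)

/-- The function `φ(κ)` from Lemma 3.3. -/
def phiProfile (p : ℝ) (n : ℕ) (P : ℕ → ℕ) : ℝ :=
  -(1 - kappaTot n P) * Real.log (1 - kappaTot n P) +
    Real.log (1/(1-p)) / 2 * ∑ u ∈ Finset.Icc 1 n,
      ((u : ℝ) * P u / n) * (alpha0 (1/(1-p)) n - 1 - 2 / Real.log (1/(1-p)) - (u : ℝ))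

/-- The function `φ̃_δ(x)` from Lemma 3.5. -/
def phiTilde (p δ x : ℝ) : ℝ :=
  -(1 - x) * Real.log (1 - x) - (1 - Real.log (1/(1-p)) / 2 * δ) * x

/-- `d_u = 2^{C(u,2)} u!`. -/
def dcoef (u : ℕ) : ℝ := 2 ^ u.choose 2 * (u.factorial : ℝ)

/-- `L_0(n,k,t)`: the supremum of `L_k` over real-valued `t`-bounded complete profiles. -/
def L0 (n k t : ℕ) : ℝ :=
  sSup {y : ℝ | ∃ f : ℕ → ℝ, (∀ u ∈ Finset.Icc 1 t, 0 ≤ f u) ∧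
    (∑ u ∈ Finset.Icc 1 t, f u = (k : ℝ)) ∧ (∑ u ∈ Finset.Icc 1 t, (u : ℝ) * f u = (n : ℝ)) ∧
    y = (n : ℝ) * Real.log n - (n : ℝ) + (k : ℝ) -
      ∑ u ∈ Finset.Icc 1 t, f u * Real.log (f u * dcoef u)}

/-- Membership in `P_{n,k,t}`: a `t`-bounded complete `k`-colouring profile on `n` vertices. -/
def IsKTProfile (n k t : ℕ) (P : ℕ → ℕ) : Prop :=
  (∀ u, u ∉ Finset.Icc 1 t → P u = 0) ∧
    (∑ u ∈ Finset.Icc 1 t, P u = k) ∧ (∑ u ∈ Finset.Icc 1 t, u * P u = n)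

/-- `E_{n,k,t}` written as the sum over profiles of `E_{1/2}[X̄_k]`. -/
def EnktSum (n k t : ℕ) : ℝ :=
  ∑ᶠ P : ℕ → ℕ, if IsKTProfile n k t P then Ep n (1/2) fun G => Xbar G P else 0

lemma alphaNat_ratio (b : ℝ) (hb : 1 < b) (hL : Tendsto (fun n : ℕ => Real.logb b n) atTop atTop) :
    Tendsto (fun n : ℕ => (alphaNat b n : ℝ) / (2 * Real.logb b n)) atTop (nhds 1) := by
  have h0 : Tendsto (fun x : ℝ => Real.logb b x / x) atTop (nhds 0) := by
    have h := (Real.isLittleO_log_id_atTop.tendsto_div_nhds_zero).div_const (Real.log b)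
    simp only [id, zero_div] at h
    refine h.congr fun x => ?_
    rw [Real.logb]; ring
  have h1 : Tendsto (fun n : ℕ => alpha0 b n / (2 * Real.logb b n)) atTop (nhds 1) := by
    have hc : Tendsto (fun n : ℕ => ((2 * Real.logb b (Real.exp 1 / 2) + 1) / 2) / Real.logb b n)
        atTop (nhds 0) := tendsto_const_nhds.div_atTop hL
    have h := ((tendsto_const_nhds (x := (1:ℝ))).sub (h0.comp hL)).add hc
    simp only [sub_zero, add_zero] at h
    refine h.congr' ?_
    filter_upwards [hL.eventually_gt_atTop 0] with n hn
    simp only [alpha0, Function.comp]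
    field_simp
    ring
  have h2L : Tendsto (fun n : ℕ => 2 * Real.logb b n) atTop atTop :=
    hL.const_mul_atTop (by norm_num)
  have hinf : Tendsto (fun n : ℕ => alpha0 b n) atTop atTop := by
    refine (h1.pos_mul_atTop one_pos h2L).congr' ?_
    filter_upwards [hL.eventually_gt_atTop 0] with n hn
    field_simp
  have h := ((tendsto_nat_floor_div_atTop (R := ℝ)).comp hinf).mul h1
  rw [mul_one] at h
  refine h.congr' ?_
  filter_upwards [hinf.eventually_gt_atTop 0] with n hn
  simp only [alphaNat, Function.comp]
  field_simp

lemma moment_summable (b : ℝ) (hb : 1 < b) (γ : ℕ → ℝ) (hγ : Tendsto γ atTop atTop) (s : ℕ) :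
    Summable (fun d : ℕ => (d : ℝ) ^ s * b ^ (-((d : ℝ) * γ d))) := by
  have hb0 : 0 < b := by linarith
  have h := summable_pow_mul_geometric_of_norm_lt_one s (r := b⁻¹)
    (by rw [Real.norm_of_nonneg (by positivity)]; exact inv_lt_one_of_one_lt₀ hb)
  refine Summable.of_norm_bounded_eventually_nat h ?_
  filter_upwards [hγ.eventually_ge_atTop 1] with d hd
  rw [Real.norm_of_nonneg (by positivity)]
  refine mul_le_mul_of_nonneg_left ?_ (by positivity)
  calc b ^ (-((d : ℝ) * γ d)) ≤ b ^ (-(d : ℝ)) := by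
        apply Real.rpow_le_rpow_of_exponent_le hb.le
        have : (0:ℝ) ≤ d := by positivity
        nlinarith
    _ = (b⁻¹) ^ d := by rw [Real.rpow_neg hb0.le, Real.rpow_natCast, inv_pow]

/-- Proposition 2.3: for a tame sequence of profiles there is `u* ~ α ~ 2 log_b n` with
`k_u = 0` for `u < u*`, and all moments `Σ_u (α−u)^s κ_u` are bounded. -/
theorem tame_profile_properties (p : ℝ) (hp : p ∈ Set.Ioo (0:ℝ) 1)
    (a : ℕ → ℕ) (P : ℕ → ℕ → ℕ)
    (ha : ∃ C : ℝ, ∀ᶠ n : ℕ in atTop, |alpha0 (1/(1-p)) n - (a n : ℝ)| ≤ C)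
    (htame : IsTame p a P) :
    ∃ ustar : ℕ → ℕ,
      Tendsto (fun n : ℕ => (ustar n : ℝ) / (alphaNat (1/(1-p)) n : ℝ)) atTop (nhds 1) ∧
      Tendsto (fun n : ℕ => (ustar n : ℝ) / (2 * Real.logb (1/(1-p)) n)) atTop (nhds 1) ∧
      (∀ᶠ n : ℕ in atTop, ∀ u, u < ustar n → P n u = 0) ∧
      ∀ s : ℕ, ∃ C : ℝ, ∀ᶠ n : ℕ in atTop,
        ∑ u ∈ Finset.Icc (ustar n) (a n),
          ((alphaNat (1/(1-p)) n - u : ℕ) : ℝ) ^ s * ((u : ℝ) * P n u / n) ≤ C := by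
  obtain ⟨hp0, hp1⟩ := hp
  obtain ⟨-, haα, hprof, c, -, γ, -, hγ, hκ, -⟩ := htame
  have hb : 1 < 1 / (1 - p) := by
    rw [lt_div_iff₀ (by linarith)]; linarith
  generalize 1 / (1 - p) = b at *
  have hb0 : 0 < b := by linarith
  have hL : Tendsto (fun n : ℕ => Real.logb b n) atTop atTop :=
    (Real.tendsto_logb_atTop hb).comp tendsto_natCast_atTop_atTop
  have hα := alphaNat_ratio b hb hL
  have hex : ∀ n : ℕ, 1 ≤ n → ∃ u, P n u ≠ 0 := by
    intro n hn
    by_contra! h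
    have h2 := (hprof n).2.1
    simp [IsCompleteProfile, h] at h2
    omega
  let us : ℕ → ℕ := fun n => sInf {u | P n u ≠ 0}
  have hus : ∀ n : ℕ, 1 ≤ n → P n (us n) ≠ 0 := fun n hn => Nat.sInf_mem (hex n hn)
  have hus1 : ∀ n : ℕ, 1 ≤ n → 1 ≤ us n := by
    intro n hn
    by_contra h
    exact hus n hn ((hprof n).1.1 _ (by simp only [Finset.mem_Icc]; omega))
  have husa : ∀ n : ℕ, 1 ≤ n → us n ≤ a n := by
    intro n hn
    by_contra h
    exact hus n hn ((hprof n).2.2 _ (by omega))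
  have hd0 : ∀ᶠ n : ℕ in atTop, ((alphaNat b n - us n : ℕ) : ℝ) * γ (alphaNat b n - us n) <
      Real.logb b n := by
    filter_upwards [hκ, eventually_ge_atTop 1] with n hn h1
    have h := hn (us n) (hus1 n h1) (husa n h1)
    have hn0 : (0:ℝ) < n := by exact_mod_cast h1
    have hge : (1:ℝ) / n ≤ (us n : ℝ) * P n (us n) / n := by
      apply div_le_div_of_nonneg_right _ hn0.le
      exact_mod_cast Nat.one_le_iff_ne_zero.mpr
        (mul_ne_zero (Nat.one_le_iff_ne_zero.mp (hus1 n h1)) (hus n h1))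
    have h3 := hge.trans_lt h
    rw [Real.rpow_neg hb0.le, one_div, inv_lt_inv₀ hn0 (by positivity)] at h3
    rwa [Real.lt_logb_iff_rpow_lt hb hn0]
  have hd : Tendsto (fun n : ℕ => ((alphaNat b n - us n : ℕ) : ℝ) / Real.logb b n) atTop
      (nhds 0) := by
    rw [Metric.tendsto_nhds]
    intro ε hε
    obtain ⟨D, hD⟩ := eventually_atTop.mp (hγ.eventually_ge_atTop (1 / ε))
    filter_upwards [hd0, hL.eventually_gt_atTop 0, hL.eventually_gt_atTop (D / ε)] with n h1 h2 h3
    rw [Real.dist_0_eq_abs, abs_of_nonneg (by positivity), div_lt_iff₀ h2]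
    rcases le_total D (alphaNat b n - us n) with h | h
    · have h4 := hD _ h
      have h5 : ((alphaNat b n - us n : ℕ) : ℝ) * (1 / ε) < Real.logb b n :=
        lt_of_le_of_lt (mul_le_mul_of_nonneg_left h4 (by positivity)) h1
      rw [mul_one_div, div_lt_iff₀ hε] at h5
      linarith
    · rw [div_lt_iff₀ hε] at h3
      have : ((alphaNat b n - us n : ℕ) : ℝ) ≤ D := by exact_mod_cast h
      linarith
  have hu2 : Tendsto (fun n : ℕ => (us n : ℝ) / (2 * Real.logb b n)) atTop (nhds 1) := by
    have h := hα.sub (hd.div_const 2)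
    simp only [zero_div, sub_zero] at h
    refine h.congr' ?_
    filter_upwards [haα, eventually_ge_atTop 1, hL.eventually_gt_atTop 0] with n h1 h2 h3
    rw [Nat.cast_sub ((husa n h2).trans h1)]
    field_simp
    ring
  refine ⟨us, ?_, hu2, ?_, ?_⟩
  · have h := hu2.div hα one_ne_zero
    rw [div_one] at h
    refine h.congr' ?_
    filter_upwards [hL.eventually_gt_atTop 0] with n h3
    exact div_div_div_cancel_right₀ (by positivity) _ _
  · refine Eventually.of_forall fun n u hu => ?_
    by_contra h
    exact Nat.notMem_of_lt_sInf hu h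
  · intro s
    refine ⟨∑' d : ℕ, (d : ℝ) ^ s * b ^ (-((d : ℝ) * γ d)), ?_⟩
    filter_upwards [hκ, haα, eventually_ge_atTop 1] with n hn h1 h2
    have hinj : Set.InjOn (fun u => alphaNat b n - u) (Finset.Icc (us n) (a n) : Finset ℕ) := by
      intro x hx y hy hxy
      simp only [Finset.coe_Icc, Set.mem_Icc] at hx hy hxy
      omega
    calc _ ≤ ∑ u ∈ Finset.Icc (us n) (a n), ((alphaNat b n - u : ℕ) : ℝ) ^ s *
            b ^ (-(((alphaNat b n - u : ℕ) : ℝ) * γ (alphaNat b n - u))) := by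
          refine Finset.sum_le_sum fun u hu => ?_
          rw [Finset.mem_Icc] at hu
          exact mul_le_mul_of_nonneg_left (hn u ((hus1 n h2).trans hu.1) hu.2).le (by positivity)
      _ = ∑ d ∈ (Finset.Icc (us n) (a n)).image (fun u => alphaNat b n - u),
            (d : ℝ) ^ s * b ^ (-((d : ℝ) * γ d)) := by
          rw [Finset.sum_image hinj]
      _ ≤ _ := (moment_summable b hb γ hγ s).sum_le_tsum _ (fun d _ => by positivity)
end
end

section
/- Let 0 < p < 1 be fixed. Let u(n) ≤ α_0(n) be an integer sequence with x = x(n) := α_0(n) − u(n) = O(1). Then μ_u = n^{x + O(ln ln n / ln n)}. Moreover, if 0 < p < 1 − e^{−4}, then μ_α = E_p[N_α] → ∞ as n → ∞. -/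
open Filter
open scoped BigOperators Classical

noncomputable section

lemma aux_stirling (u : ℕ) (hu : 1 ≤ u) :
    (u:ℝ) * Real.log u - u + 1/2 * Real.log u ≤ Real.log (u.factorial) ∧
    Real.log (u.factorial) ≤ (u:ℝ) * Real.log u - u + 1/2 * Real.log u + 1 := by
  have hu0 : (0:ℝ) < u := by exact_mod_cast hu
  have h1 := Stirling.log_stirlingSeq_formula u
  have e1 : Real.log (2 * (u:ℝ)) = Real.log 2 + Real.log u :=
    Real.log_mul (by norm_num) hu0.ne'
  have e2 : Real.log ((u:ℝ) / Real.exp 1) = Real.log u - 1 := by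
    rw [Real.log_div hu0.ne' (Real.exp_pos 1).ne', Real.log_exp]
  rw [e1, e2] at h1
  obtain ⟨k, rfl⟩ : ∃ k, u = k + 1 := ⟨u - 1, by omega⟩
  have hup : Real.log (Stirling.stirlingSeq (k+1)) ≤ 1 - 1/2 * Real.log 2 := by
    have h2 : Real.log (Stirling.stirlingSeq (k+1)) ≤ Real.log (Stirling.stirlingSeq (0+1)) :=
      Stirling.log_stirlingSeq'_antitone (Nat.zero_le k)
    have h3 := Stirling.log_stirlingSeq_formula 1
    simp at h2 h3
    linarith
  have hlo : 0 ≤ Real.log (Stirling.stirlingSeq (k+1)) := by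
    apply Real.log_nonneg
    have h4 := Stirling.sqrt_pi_le_stirlingSeq (n := k+1) (by omega)
    refine le_trans ?_ h4
    rw [Real.one_le_sqrt]
    linarith [Real.pi_gt_three]
  have hl2 : 0 ≤ Real.log 2 := Real.log_nonneg (by norm_num)
  constructor <;> nlinarith

lemma aux_choose (n u : ℕ) (hu : 1 ≤ u) (h : u ^ 2 ≤ n) :
    (u:ℝ) * Real.log n - 1 ≤ Real.log (n.choose u) + Real.log u.factorial ∧
    Real.log (n.choose u) + Real.log u.factorial ≤ (u:ℝ) * Real.log n := by
  have hun : u ≤ n := by nlinarith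
  have hu1 : (1:ℝ) ≤ u := by exact_mod_cast hu
  have hn0 : (0:ℝ) < n := by exact_mod_cast (by omega : 0 < n)
  have hc : (0:ℝ) < n.choose u := by exact_mod_cast Nat.choose_pos hun
  have hf : (0:ℝ) < u.factorial := by exact_mod_cast Nat.factorial_pos u
  have e : Real.log (n.choose u) + Real.log u.factorial = Real.log (n.descFactorial u) := by
    rw [← Real.log_mul hc.ne' hf.ne', Nat.descFactorial_eq_factorial_mul_choose]
    push_cast
    rw [mul_comm]
  have hd : (0:ℝ) < n.descFactorial u := by
    rw [Nat.descFactorial_eq_factorial_mul_choose]; push_cast; positivity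
  rw [e]
  have hm : (0:ℝ) < (n:ℝ) + 1 - u := by
    have : (u:ℝ) ≤ n := by exact_mod_cast hun
    linarith
  constructor
  · have h1 : (((n + 1 - u : ℕ):ℝ)) ^ u ≤ n.descFactorial u := by
      exact_mod_cast Nat.pow_sub_le_descFactorial n u
    rw [Nat.cast_sub (by omega)] at h1
    push_cast at h1
    have h2 := Real.log_le_log (by positivity) h1
    rw [Real.log_pow] at h2
    have h3 := Real.one_sub_inv_le_log_of_pos (x := ((n:ℝ) + 1 - u)/n) (by positivity)
    rw [Real.log_div hm.ne' hn0.ne', inv_div] at h3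
    have h4 : -1 ≤ (u:ℝ) * (1 - (n:ℝ) / ((n:ℝ)+1-u)) := by
      have : (u:ℝ) * (1 - (n:ℝ) / ((n:ℝ)+1-u)) = (u * (1 - u)) / ((n:ℝ)+1-u) := by
        field_simp; ring
      rw [this, le_div_iff₀ hm]
      have : (u:ℝ)^2 ≤ n := by exact_mod_cast h
      nlinarith
    have h5 := mul_le_mul_of_nonneg_left h3 (by linarith : (0:ℝ) ≤ u)
    nlinarith
  · have h1 : (n.descFactorial u : ℝ) ≤ (n:ℝ)^u := by exact_mod_cast Nat.descFactorial_le_pow n u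
    have h2 := Real.log_le_log hd h1
    rwa [Real.log_pow] at h2

lemma aux_core (lam C : ℝ) (hlam : 0 < lam) (hC : 0 ≤ C) : ∃ K : ℝ, ∀ (n u : ℕ) (l M x r q : ℝ),
    0 < q → Real.log q = -lam → l = Real.log n / lam → M = Real.log l → 2 ≤ l →
    x = (2 * l - 2 * (M / lam) + 2 * ((1 - Real.log 2)/lam) + 1) - u → 0 ≤ x → x ≤ C →
    r = 2 * l - u → r ^ 2 ≤ 2 * l → (3 * l)^2 ≤ n →
    |Real.log (muExp q n u) - (x * Real.log n + (2/lam - 1/2 - x) * M)| ≤ K := by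
  refine ⟨C * (1 + lam * C + lam) + (2/lam + 1 + C) + 5, ?_⟩
  intro n u l M x r q hq hlq hl hM h2l hx hx0 hxC hr hrl hn
  have hl0 : 0 < l := by linarith
  have hrabs : |r| ≤ l := by
    apply abs_le_of_sq_le_sq _ hl0.le
    nlinarith
  obtain ⟨hr1, hr2⟩ := abs_le.1 hrabs
  have hul : l ≤ u := by linarith
  have hul' : (u:ℝ) ≤ 3 * l := by linarith
  have hu0 : (0:ℝ) < u := by linarith
  have hu : 1 ≤ u := by exact_mod_cast hu0
  have hun : u ^ 2 ≤ n := by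
    have : (u:ℝ)^2 ≤ n := by nlinarith
    exact_mod_cast this
  have hL : Real.log n = lam * l := by rw [hl]; field_simp
  obtain ⟨s1, s2⟩ := aux_stirling u hu
  obtain ⟨c1, c2⟩ := aux_choose n u hu hun
  have hc : (0:ℝ) < n.choose u := by
    exact_mod_cast Nat.choose_pos (by nlinarith)
  have hmu : Real.log (muExp q n u) = Real.log (n.choose u) - lam * ((u:ℝ) * (u - 1) / 2) := by
    unfold muExp
    rw [Real.log_mul hc.ne' (by positivity), Real.log_pow, hlq, Nat.cast_choose_two]
    ring
  -- logarithm of the ratio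
  set T := Real.log (2 * l / u) with hT
  have hTe : T = Real.log 2 + M - Real.log u := by
    rw [hT, Real.log_div (by positivity) hu0.ne', Real.log_mul (by norm_num) hl0.ne', hM]
  have t1 : u * T ≤ r := by
    have := Real.log_le_sub_one_of_pos (x := 2 * l / u) (by positivity)
    have h := mul_le_mul_of_nonneg_left this hu0.le
    have e : (u:ℝ) * (2 * l / u - 1) = r := by rw [hr]; field_simp
    rw [e] at h
    exact h
  have t2 : r - 1 ≤ u * T := by
    have := Real.one_sub_inv_le_log_of_pos (x := 2 * l / u) (by positivity)
    have h := mul_le_mul_of_nonneg_left this hu0.le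
    have e : (u:ℝ) * (1 - (2 * l / u)⁻¹) = r - r^2 / (2 * l) := by
      rw [hr]; field_simp; ring
    rw [e] at h
    have : r^2 / (2*l) ≤ 1 := by rw [div_le_one (by positivity)]; exact hrl
    linarith
  have u1 : M ≤ Real.log u := by rw [hM]; exact Real.log_le_log hl0 hul
  have u2 : Real.log u ≤ M + 2 := by
    have h := Real.log_le_log hu0 hul'
    rw [Real.log_mul (by norm_num) hl0.ne', ← hM] at h
    have := Real.log_le_sub_one_of_pos (x := 3) (by norm_num)
    linarith
  have g1 : 0 < Real.log 2 := Real.log_pos (by norm_num)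
  have g2 : Real.log 2 < 1 := by linarith [Real.log_two_lt_d9]
  set k := Real.log 2 with hk
  have hlu : lam * u = 2 * (lam * l) - 2 * M + 2 * (1 - k) + lam - lam * x := by
    have : (u:ℝ) = (2 * l - 2 * (M / lam) + 2 * ((1 - k)/lam) + 1) - x := by linarith
    rw [this]; field_simp
  have hre : r = 2 / lam * M + (-2 * ((1-k)/lam) - 1 + x) := by
    rw [hr]; linear_combination (-1 : ℝ) * hx
  have hk1 : 0 ≤ (1-k)/lam := by apply div_nonneg <;> linarith
  have hk2 : (1-k)/lam ≤ 1/lam := by gcongr; linarith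
  have hk3 : 2/lam = 2 * (1/lam) := by ring
  -- main identity
  have hid : u * Real.log n - (u * Real.log u - u + 1/2 * Real.log u)
      - lam * ((u:ℝ) * (u - 1) / 2) =
      (x * Real.log n - x * M + x * (1 - k - lam * x / 2 + lam / 2)) + u * T
        - 1/2 * Real.log u := by
    rw [hL, hTe]
    linear_combination ((x - u)/2) * hlu
  have hbd1 : x * (1 - k - lam * x / 2 + lam / 2) ≤ C * (1 + lam * C + lam) := by
    have hlx : 0 ≤ lam * x := by positivity
    have hlC : 0 ≤ lam * C := by positivity
    calc _ ≤ x * (1 + lam * C + lam) := by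
          apply mul_le_mul_of_nonneg_left _ hx0; linarith
      _ ≤ _ := by apply mul_le_mul_of_nonneg_right hxC; linarith
  have hbd2 : -(C * (1 + lam * C + lam)) ≤ x * (1 - k - lam * x / 2 + lam / 2) := by
    have hlx : lam * x ≤ lam * C := by gcongr
    have hlC : 0 ≤ lam * C := by positivity
    have : x * (-(1 + lam * C + lam)) ≤ x * (1 - k - lam * x / 2 + lam / 2) := by
      apply mul_le_mul_of_nonneg_left _ hx0; linarith
    have h2 : x * (1 + lam * C + lam) ≤ C * (1 + lam * C + lam) := by
      apply mul_le_mul_of_nonneg_right hxC; linarith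
    linarith
  rw [hmu, abs_le]
  constructor <;> linarith

lemma aux_main (p : ℝ) (hp : p ∈ Set.Ioo (0:ℝ) 1) (u : ℕ → ℕ)
    (hu : ∀ᶠ n : ℕ in atTop, (u n : ℝ) ≤ alpha0 (1/(1-p)) n)
    (hx : ∃ C : ℝ, ∀ᶠ n : ℕ in atTop, alpha0 (1/(1-p)) n - (u n : ℝ) ≤ C) :
    ∃ K : ℝ, ∀ᶠ n : ℕ in atTop, |Real.log (muExp (1-p) n (u n)) -
      ((alpha0 (1/(1-p)) n - (u n : ℝ)) * Real.log n +
        (2 / (-Real.log (1-p)) - 1/2 - (alpha0 (1/(1-p)) n - (u n : ℝ))) *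
          Real.log (Real.log n / (-Real.log (1-p))))| ≤ K := by
  obtain ⟨hp0, hp1⟩ := hp
  obtain ⟨C', hC'⟩ := hx
  set lam := -Real.log (1-p) with hlam
  have hlam0 : 0 < lam := by
    have := Real.log_neg (x := 1-p) (by linarith) (by linarith)
    linarith
  have hlb : Real.log (1/(1-p)) = lam := by rw [one_div, Real.log_inv]
  obtain ⟨K, hK⟩ := aux_core lam (max C' 0) hlam0 (le_max_right _ _)
  refine ⟨K, ?_⟩
  set C := max C' 0 with hC
  have hlim : Tendsto (fun n : ℕ => Real.log n / lam) atTop atTop :=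
    (Real.tendsto_log_atTop.comp tendsto_natCast_atTop_atTop).atTop_div_const hlam0
  have h2 : ∀ᶠ n : ℕ in atTop, 2 ≤ Real.log n / lam := hlim.eventually_ge_atTop 2
  -- r bound
  have hr : ∀ᶠ l : ℝ in atTop, (2 / lam * |Real.log l| + (2/lam + 1 + C))^2 ≤ 2 * l := by
    have o1 : (fun l : ℝ => 2 / lam * |Real.log l| + (2/lam + 1 + C)) =o[atTop]
        (fun l : ℝ => l ^ (1/2:ℝ)) := by
      apply Asymptotics.IsLittleO.add
      · exact ((isLittleO_log_rpow_atTop (by norm_num : (0:ℝ) < 1/2)).abs_left).const_mul_left _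
      · apply Asymptotics.isLittleO_const_left.2
        right
        exact tendsto_norm_atTop_atTop.comp (tendsto_rpow_atTop (by norm_num))
    filter_upwards [o1.bound (zero_lt_one), eventually_ge_atTop 0] with l hl hl0
    rw [Real.norm_eq_abs, Real.norm_eq_abs, one_mul, ← Real.sqrt_eq_rpow] at hl
    have := sq_le_sq.2 hl
    rw [Real.sq_sqrt hl0] at this
    linarith
  have hr' := hlim.eventually hr
  have hn : ∀ᶠ n : ℕ in atTop, (3 * (Real.log n / lam))^2 ≤ n := by
    have o1 : (fun l : ℝ => 3 * (Real.log l / lam)) =o[atTop] (fun l : ℝ => l ^ (1/2:ℝ)) := by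
      have := (isLittleO_log_rpow_atTop (by norm_num : (0:ℝ) < 1/2)).const_mul_left (3 / lam)
      refine this.congr_left ?_
      intro l; ring
    have o2 : ∀ᶠ l : ℝ in atTop, (3 * (Real.log l / lam))^2 ≤ l := by
      filter_upwards [o1.bound (zero_lt_one), eventually_ge_atTop 0] with l hl hl0
      rw [Real.norm_eq_abs, Real.norm_eq_abs, one_mul, ← Real.sqrt_eq_rpow] at hl
      have := sq_le_sq.2 hl
      rwa [Real.sq_sqrt hl0] at this
    exact tendsto_natCast_atTop_atTop.eventually o2
  filter_upwards [hu, hC', h2, hr', hn] with n hun hCn h2n hrn hnn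
  have ha : alpha0 (1/(1-p)) n = 2 * (Real.log n / lam) - 2 * (Real.log (Real.log n / lam) / lam)
      + 2 * ((1 - Real.log 2)/lam) + 1 := by
    unfold alpha0 Real.logb
    rw [hlb, Real.log_div (Real.exp_pos 1).ne' (by norm_num), Real.log_exp]
  have hxC : alpha0 (1/(1-p)) n - (u n : ℝ) ≤ C := hCn.trans (le_max_left _ _)
  refine hK n (u n) (Real.log n / lam) _ _ (2 * (Real.log n / lam) - u n) (1-p) (by linarith)
    (by linarith) rfl rfl h2n (by rw [ha]) (by linarith) hxC rfl ?_ hnn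
  refine le_trans ?_ hrn
  apply sq_le_sq.2
  rw [abs_of_nonneg (a := 2 / lam * |Real.log (Real.log n / lam)| + (2/lam + 1 + C))
    (by have := le_max_right C' 0; positivity)]
  have g1 : 0 < Real.log 2 := Real.log_pos (by norm_num)
  have g2 : Real.log 2 < 1 := by linarith [Real.log_two_lt_d9]
  set k := Real.log 2 with hk
  have hk1 : 0 ≤ (1-k)/lam := by apply div_nonneg <;> linarith
  have hk2 : (1-k)/lam ≤ 1/lam := by gcongr; linarith
  have hk3 : 2/lam = 2 * (1/lam) := by ring
  have hM0 : 0 ≤ Real.log (Real.log n / lam) := Real.log_nonneg (by linarith)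
  rw [abs_of_nonneg hM0]
  have hM1 : 2 / lam * Real.log (Real.log n / lam) = 2 * (Real.log (Real.log n / lam) / lam) := by
    ring
  have hM2 : 0 ≤ Real.log (Real.log n / lam) / lam := by positivity
  rw [hM1, abs_le]
  constructor <;> linarith

/-- Lemma 3.1: `μ_u = n^{x + O(ln ln n / ln n)}` for `u ≤ α₀` with `x = α₀ − u = O(1)`;
moreover `μ_α → ∞` when `p < 1 − e^{−4}`. -/
theorem mu_near_alpha0 (p : ℝ) (hp : p ∈ Set.Ioo (0:ℝ) 1)
    (u : ℕ → ℕ)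
    (hu : ∀ᶠ n : ℕ in atTop, (u n : ℝ) ≤ alpha0 (1/(1-p)) n)
    (hx : ∃ C : ℝ, ∀ᶠ n : ℕ in atTop, alpha0 (1/(1-p)) n - (u n : ℝ) ≤ C) :
    (∃ C : ℝ, 0 < C ∧ ∀ᶠ n : ℕ in atTop,
      |Real.log (muExp (1-p) n (u n)) -
        (alpha0 (1/(1-p)) n - (u n : ℝ)) * Real.log n| ≤ C * Real.log (Real.log n)) ∧
    (p < 1 - Real.exp (-4) →
      Tendsto (fun n : ℕ => muExp (1-p) n (alphaNat (1/(1-p)) n)) atTop atTop) := by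
  obtain ⟨hp0, hp1⟩ := id hp
  have hlam0 : 0 < -Real.log (1-p) := by
    have := Real.log_neg (x := 1-p) (by linarith) (by linarith)
    linarith
  have hlL : Tendsto (fun n : ℕ => Real.log (n:ℝ)) atTop atTop :=
    Real.tendsto_log_atTop.comp tendsto_natCast_atTop_atTop
  have hlim : Tendsto (fun n : ℕ => Real.log n / (-Real.log (1-p))) atTop atTop :=
    hlL.atTop_div_const hlam0
  have hM : Tendsto (fun n : ℕ => Real.log (Real.log n / (-Real.log (1-p)))) atTop atTop :=
    Real.tendsto_log_atTop.comp hlim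
  have hLL : Tendsto (fun n : ℕ => Real.log (Real.log n)) atTop atTop :=
    Real.tendsto_log_atTop.comp hlL
  constructor
  · obtain ⟨K, hK⟩ := aux_main p hp u hu hx
    obtain ⟨C, hC⟩ := hx
    set lam := -Real.log (1-p) with hlam
    refine ⟨|K| + (2 / lam + 1/2 + |C|) * (1 + |Real.log lam|), by positivity, ?_⟩
    filter_upwards [hK, hC, hu, hlL.eventually_ge_atTop 1, hLL.eventually_ge_atTop 1]
      with n h1 h2 h3 h4 h5
    set x := alpha0 (1/(1-p)) n - (u n : ℝ) with hxdef
    have hx0 : 0 ≤ x := by linarith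
    have hMe : Real.log (Real.log n / lam) = Real.log (Real.log n) - Real.log lam :=
      Real.log_div (by linarith) hlam0.ne'
    set LL := Real.log (Real.log n) with hLLdef
    have b1 : |Real.log (Real.log n / lam)| ≤ (1 + |Real.log lam|) * LL := by
      rw [hMe]
      have := abs_sub LL (Real.log lam)
      rw [abs_of_nonneg (by linarith : 0 ≤ LL)] at this
      nlinarith [abs_nonneg (Real.log lam)]
    have b2 : |2 / lam - 1/2 - x| ≤ 2 / lam + 1/2 + |C| := by
      have : 0 ≤ 2 / lam := by positivity
      rw [abs_le]
      constructor <;> linarith [le_abs_self C, abs_nonneg C]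
    have b3 : |(2 / lam - 1/2 - x) * Real.log (Real.log n / lam)| ≤
        (2 / lam + 1/2 + |C|) * ((1 + |Real.log lam|) * LL) := by
      rw [abs_mul]
      exact mul_le_mul b2 b1 (abs_nonneg _) (by positivity)
    have b4 : K ≤ |K| * LL := by nlinarith [le_abs_self K, abs_nonneg K]
    rw [abs_le] at h1 b3 ⊢
    constructor <;> linarith [h1.1, h1.2, b3.1, b3.2]
  · intro hp4
    have hlam4 : -Real.log (1-p) < 4 := by
      have := Real.log_lt_log (Real.exp_pos (-4)) (by linarith : Real.exp (-4) < 1 - p)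
      rw [Real.log_exp] at this
      linarith
    have hapos : ∀ᶠ n : ℕ in atTop, 0 ≤ alpha0 (1/(1-p)) n := by
      have o1 : ∀ᶠ l : ℝ in atTop, Real.log l ≤ (-Real.log (1-p)) * l := by
        filter_upwards [Real.isLittleO_log_id_atTop.bound hlam0, eventually_ge_atTop 0]
          with l hl hl0
        simp only [id, Real.norm_eq_abs, abs_of_nonneg hl0] at hl
        exact (le_abs_self _).trans hl
      filter_upwards [hlim.eventually o1] with n h1
      have hlb : Real.log (1/(1-p)) = -Real.log (1-p) := by rw [one_div, Real.log_inv]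
      unfold alpha0 Real.logb
      rw [hlb, Real.log_div (Real.exp_pos 1).ne' (by norm_num), Real.log_exp]
      have h2 : Real.log (Real.log n / (-Real.log (1-p))) / (-Real.log (1-p)) ≤
          Real.log n / (-Real.log (1-p)) := by
        rw [div_le_iff₀ hlam0]
        linarith
      have h3 : 0 ≤ (1 - Real.log 2) / (-Real.log (1-p)) :=
        div_nonneg (by linarith [Real.log_two_lt_d9]) hlam0.le
      linarith
    have hle : ∀ᶠ n : ℕ in atTop,
        ((alphaNat (1/(1-p)) n : ℕ) : ℝ) ≤ alpha0 (1/(1-p)) n := by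
      filter_upwards [hapos] with n h
      exact Nat.floor_le h
    have hge : ∀ᶠ n : ℕ in atTop,
        alpha0 (1/(1-p)) n - ((alphaNat (1/(1-p)) n : ℕ) : ℝ) ≤ 1 := by
      filter_upwards with n
      have := Nat.lt_floor_add_one (alpha0 (1/(1-p)) n)
      unfold alphaNat
      linarith
    obtain ⟨K, hK⟩ := aux_main p hp (fun n => alphaNat (1/(1-p)) n) hle ⟨1, hge⟩
    have hML : ∀ᶠ n : ℕ in atTop,
        Real.log (Real.log n / (-Real.log (1-p))) ≤ Real.log n := by
      have o1 : ∀ᶠ l : ℝ in atTop, Real.log l ≤ (-Real.log (1-p)) * l := by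
        filter_upwards [Real.isLittleO_log_id_atTop.bound hlam0, eventually_ge_atTop 0]
          with l hl hl0
        simp only [id, Real.norm_eq_abs, abs_of_nonneg hl0] at hl
        exact (le_abs_self _).trans hl
      filter_upwards [hlim.eventually o1] with n h1
      rwa [mul_div_cancel₀ _ hlam0.ne'] at h1
    have hc : 0 < 2 / (-Real.log (1-p)) - 1/2 := by
      have : 1/2 < 2 / (-Real.log (1-p)) := by
        rw [lt_div_iff₀ hlam0]; linarith
      linarith
    have hT : Tendsto (fun n : ℕ => (2 / (-Real.log (1-p)) - 1/2) *
        Real.log (Real.log n / (-Real.log (1-p))) + (1 - K)) atTop atTop :=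
      tendsto_atTop_add_const_right _ _ (hM.const_mul_atTop hc)
    refine tendsto_atTop_mono' _ ?_ hT
    filter_upwards [hK, hle, hML, hT.eventually_ge_atTop 2] with n h1 h2 h3 h4
    have h5 := (abs_le.1 h1).1
    have h6 := mul_nonneg (sub_nonneg.2 h2) (sub_nonneg.2 h3)
    have h7 : (2 / (-Real.log (1-p)) - 1/2) *
        Real.log (Real.log n / (-Real.log (1-p))) - K ≤
        Real.log (muExp (1-p) n (alphaNat (1/(1-p)) n)) := by
      nlinarith
    have hmu0 : 0 ≤ muExp (1-p) n (alphaNat (1/(1-p)) n) := by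
      unfold muExp
      have : 0 ≤ 1 - p := by linarith
      positivity
    rcases hmu0.eq_or_lt with h0 | h0
    · rw [← h0, Real.log_zero] at h7
      linarith
    · have := Real.log_le_sub_one_of_pos h0
      linarith
end
end

section
/- Let 0 < p < 1 be fixed. Let a = a(n) = α_0(n) − O(1) and u = u(n) be integer sequences with 0.1·α ≤ u ≤ 10·α. Then, uniformly in u, μ_u = μ_a · (Θ( (n/ln n) · b^{−(a−u)/2} ))^{a−u}. -/
open Filter
open scoped BigOperators Classical

noncomputable section

/-- One-sided comparison of binomial coefficients. -/
lemma choose_ratio_le (n a u : ℕ) (A B : ℝ) (hA : 0 < A) (hua : u ≤ a) (han : a ≤ n)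
    (h : ∀ i : ℕ, u ≤ i → i < a →
      A ≤ ((i : ℝ) + 1) / ((n : ℝ) - i) ∧ ((i : ℝ) + 1) / ((n : ℝ) - i) ≤ B) :
    (n.choose a : ℝ) * A ^ (a - u) ≤ n.choose u ∧
      (n.choose u : ℝ) ≤ n.choose a * B ^ (a - u) := by
  induction a, hua using Nat.le_induction with
  | base => simp
  | succ k hk ih =>
    obtain ⟨ih1, ih2⟩ := ih (by omega) (fun i h1 h2 => h i h1 (by omega))
    obtain ⟨h1, h2⟩ := h k hk (by omega)
    have hB : 0 < B := lt_of_lt_of_le hA (h1.trans h2)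
    have hnk : (0:ℝ) < (n:ℝ) - k := by
      have : (k:ℝ) + 1 ≤ n := by exact_mod_cast han
      linarith
    have key : (n.choose k : ℝ) = n.choose (k+1) * (((k : ℝ) + 1) / ((n : ℝ) - k)) := by
      have := Nat.choose_succ_right_eq n k
      have h3 : ((n.choose (k+1) * (k+1) : ℕ) : ℝ) = ((n.choose k * (n - k) : ℕ) : ℝ) := by
        rw [this]
      rw [Nat.cast_mul, Nat.cast_mul, Nat.cast_sub (by omega)] at h3
      push_cast at h3
      field_simp
      linarith
    have hs : k + 1 - u = (k - u) + 1 := by omega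
    rw [hs, pow_succ, pow_succ]
    have hc : (0:ℝ) ≤ n.choose (k+1) := by positivity
    constructor
    · calc (n.choose (k+1) : ℝ) * (A ^ (k-u) * A) = (n.choose (k+1) * A) * A ^ (k-u) := by ring
        _ ≤ n.choose k * A ^ (k-u) := by
            rw [key]; gcongr
        _ ≤ _ := ih1
    · calc (n.choose u : ℝ) ≤ n.choose k * B ^ (k-u) := ih2
        _ ≤ (n.choose (k+1) * B) * B ^ (k-u) := by
            rw [key]; gcongr
        _ = _ := by ring

lemma choose_ratio_nat (n a u : ℕ) (A B : ℝ) (hA : 0 < A) (hAB : A ≤ B) (hua : u ≤ a) (han : a ≤ n)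
    (h : ∀ i : ℕ, u ≤ i → i < a →
      A ≤ ((i : ℝ) + 1) / ((n : ℝ) - i) ∧ ((i : ℝ) + 1) / ((n : ℝ) - i) ≤ B) :
    ∃ t : ℝ, A ≤ t ∧ t ≤ B ∧ (n.choose u : ℝ) = n.choose a * t ^ (a - u) := by
  obtain ⟨h1, h2⟩ := choose_ratio_le n a u A B hA hua han h
  have hc : (0:ℝ) < n.choose a := by exact_mod_cast Nat.choose_pos han
  rcases hua.eq_or_lt with rfl | hlt
  · exact ⟨A, le_rfl, hAB, by simp⟩
  have hcont : ContinuousOn (fun t : ℝ => (n.choose a : ℝ) * t ^ (a - u)) (Set.Icc A B) := by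
    fun_prop
  obtain ⟨t, ht, hte⟩ := intermediate_value_Icc hAB hcont ⟨h1, h2⟩
  exact ⟨t, ht.1, ht.2, hte.symm⟩

lemma choose_ratio_int (n a u : ℕ) (A B : ℝ) (hA : 0 < A) (hAB : A ≤ B) (hun : u ≤ n) (han : a ≤ n)
    (h : ∀ i : ℕ, min a u ≤ i → i < max a u →
      A ≤ ((i : ℝ) + 1) / ((n : ℝ) - i) ∧ ((i : ℝ) + 1) / ((n : ℝ) - i) ≤ B) :
    ∃ t : ℝ, A ≤ t ∧ t ≤ B ∧ (n.choose u : ℝ) = n.choose a * t ^ ((a : ℤ) - (u : ℤ)) := by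
  rcases le_total u a with hua | hau
  · obtain ⟨t, h1, h2, h3⟩ := choose_ratio_nat n a u A B hA hAB hua han
      (fun i hi hi2 => h i (by omega) (by omega))
    refine ⟨t, h1, h2, ?_⟩
    rw [h3, ← Nat.cast_sub hua, zpow_natCast]
  · obtain ⟨t, h1, h2, h3⟩ := choose_ratio_nat n u a A B hA hAB hau hun
      (fun i hi hi2 => h i (by omega) (by omega))
    refine ⟨t, h1, h2, ?_⟩
    have ht : 0 < t := hA.trans_le h1
    have : (a : ℤ) - u = -((u - a : ℕ) : ℤ) := by push_cast [hau]; ring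
    rw [h3, this, zpow_neg, zpow_natCast]
    field_simp

lemma q_pow_choose (q : ℝ) (hq : 0 < q) (a u : ℕ) :
    q ^ u.choose 2 = q ^ a.choose 2 *
      ((1/q) ^ ((a:ℝ) - 1/2) * (1/q) ^ (-(((a : ℝ) - (u : ℝ)) / 2))) ^ ((a : ℤ) - (u : ℤ)) := by
  have hb : 0 < 1 / q := by positivity
  have e : ∀ k : ℕ, q ^ k.choose 2 = (1/q) ^ (-((k:ℝ) * (k - 1) / 2)) := by
    intro k
    rw [← Nat.cast_choose_two, Real.rpow_neg hb.le, Real.rpow_natCast]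
    simp
  rw [e, e, ← Real.rpow_add hb, ← Real.rpow_intCast, ← Real.rpow_mul hb.le, ← Real.rpow_add hb]
  congr 1
  push_cast
  ring

lemma alpha0_rpow (b : ℝ) (hb : 1 < b) (n : ℕ) (hn : 1 < n) :
    b ^ alpha0 b n = (n : ℝ)^2 / (Real.log n)^2 * ((Real.log b)^2 * (Real.exp 1 / 2)^2 * b) := by
  have hb0 : 0 < b := by linarith
  have hn1 : (1:ℝ) < n := by exact_mod_cast hn
  have hl : 0 < Real.log n := Real.log_pos hn1
  have hlb : 0 < Real.log b := Real.log_pos hb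
  have e : ∀ x : ℝ, 0 < x → b ^ (2 * Real.logb b x) = x ^ 2 := by
    intro x hx
    rw [mul_comm, Real.rpow_mul hb0.le, Real.rpow_logb hb0 hb.ne' hx]
    norm_num
  unfold alpha0
  have hlogb : 0 < Real.logb b n := Real.logb_pos hb hn1
  rw [Real.rpow_add hb0, Real.rpow_add hb0, Real.rpow_sub hb0, e (n : ℝ) (by positivity),
    e _ hlogb, e (Real.exp 1 / 2) (by positivity), Real.rpow_one]
  unfold Real.logb
  field_simp

lemma alpha0_bounds (b : ℝ) (hb : 1 < b) (D : ℝ) : ∀ᶠ n : ℕ in atTop,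
    (1/2) * Real.log n / Real.log b ≤ alpha0 b n - D ∧
    alpha0 b n + D ≤ (3:ℝ) * Real.log n / Real.log b := by
  have hlb : 0 < Real.log b := Real.log_pos hb
  have hx : Tendsto (fun n : ℕ => Real.logb b n) atTop atTop := by
    have : Tendsto (fun n : ℕ => Real.log n) atTop atTop :=
      Real.tendsto_log_atTop.comp tendsto_natCast_atTop_atTop
    exact this.atTop_div_const hlb
  have hlo : (fun x : ℝ => Real.log x) =o[atTop] (fun x : ℝ => x) := Real.isLittleO_log_id_atTop
  have h1 : ∀ᶠ x : ℝ in atTop, |Real.logb b x| ≤ x / 8 := by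
    filter_upwards [hlo.bound (show 0 < Real.log b / 8 by positivity), eventually_gt_atTop 0]
      with x hx hx0
    rw [Real.norm_eq_abs, Real.norm_eq_abs, abs_of_pos hx0] at hx
    rw [Real.logb, abs_div, abs_of_pos hlb, div_le_iff₀ hlb]
    linarith
  filter_upwards [hx.eventually h1, hx.eventually (eventually_ge_atTop
    (8 * (|2 * Real.logb b (Real.exp 1 / 2) + 1| + |D|)))] with n h2 h3
  have := abs_le.1 h2
  have h5 := neg_abs_le (2 * Real.logb b (Real.exp 1 / 2) + 1)
  have h6 := le_abs_self (2 * Real.logb b (Real.exp 1 / 2) + 1)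
  have h7 := le_abs_self D
  rw [mul_div_assoc, mul_div_assoc]
  change (1/2) * Real.logb b n ≤ _ ∧ _ ≤ (3:ℝ) * Real.logb b n
  unfold alpha0
  constructor <;> linarith

/-- Lemma 3.2: uniformly for `0.1 α ≤ u ≤ 10 α`,
`μ_u = μ_a · (Θ((n/ln n) b^{−(a−u)/2}))^{a−u}`. -/
theorem mu_ratio_formula (p : ℝ) (hp : p ∈ Set.Ioo (0:ℝ) 1)
    (a : ℕ → ℕ)
    (ha : ∃ C : ℝ, ∀ᶠ n : ℕ in atTop, |alpha0 (1/(1-p)) n - (a n : ℝ)| ≤ C) :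
    ∃ c₁ c₂ : ℝ, 0 < c₁ ∧ c₁ ≤ c₂ ∧ ∀ᶠ n : ℕ in atTop, ∀ u : ℕ,
      (0.1 : ℝ) * (alphaNat (1/(1-p)) n : ℝ) ≤ (u : ℝ) →
      (u : ℝ) ≤ 10 * (alphaNat (1/(1-p)) n : ℝ) →
      ∃ c : ℝ, c₁ ≤ c ∧ c ≤ c₂ ∧
        muExp (1-p) n u = muExp (1-p) n (a n) *
          (c * ((n : ℝ) / Real.log n) *
            (1/(1-p)) ^ (-(((a n : ℝ) - (u : ℝ)) / 2))) ^ ((a n : ℤ) - (u : ℤ)) := by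
  obtain ⟨hp0, hp1⟩ := hp
  obtain ⟨C, hC⟩ := ha
  have hq : 0 < 1 - p := by linarith
  have hb : 1 < 1 / (1 - p) := by rw [lt_div_iff₀ hq]; linarith
  have hlb : 0 < Real.log (1 / (1 - p)) := Real.log_pos hb
  have hKp : 0 < (Real.log (1 / (1 - p)))^2 * (Real.exp 1 / 2)^2 * (1 / (1 - p)) := by positivity
  have hqp := q_pow_choose (1 - p) hq
  have hrp := alpha0_rpow _ hb
  have hbd := alpha0_bounds _ hb
  unfold muExp alphaNat
  generalize 1 / (1 - p) = b at *
  have hb0 : 0 < b := by linarith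
  set ℓ := Real.log b with hℓ
  set K := ℓ^2 * (Real.exp 1 / 2)^2 * b with hK
  have hlog : Tendsto (fun n : ℕ => Real.log n) atTop atTop :=
    Real.tendsto_log_atTop.comp tendsto_natCast_atTop_atTop
  have hlo : ∀ᶠ n : ℕ in atTop, Real.log n ≤ ℓ / 60 * n := by
    have hlo : (fun x : ℝ => Real.log x) =o[atTop] (fun x : ℝ => x) :=
      Real.isLittleO_log_id_atTop
    have := tendsto_natCast_atTop_atTop (R := ℝ) |>.eventually
      (hlo.bound (show 0 < ℓ / 60 by positivity))
    filter_upwards [this] with n hn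
    rw [Real.norm_eq_abs, Real.norm_eq_abs, abs_of_nonneg (Nat.cast_nonneg n : (0:ℝ) ≤ (n:ℝ))] at hn
    exact (le_abs_self _).trans hn
  set C' := max C 0 with hC'
  refine ⟨(1/20) / ℓ * K * b ^ (-C' - 1/2), 60 / ℓ * K * b ^ (C' - 1/2), by positivity, ?_, ?_⟩
  · have : (0:ℝ) ≤ C' := le_max_right _ _
    gcongr
    · norm_num
    · exact hb.le
    · linarith
  filter_upwards [hC, hlo, hbd (max C' 1), eventually_gt_atTop 1] with n hCn hlon hbn hn1 u hu1 hu2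
  have hn1' : (1:ℝ) < n := by exact_mod_cast hn1
  have hL : 0 < Real.log n := Real.log_pos hn1'
  set L := Real.log n with hLdef
  set x := alpha0 b n with hx
  have hCC : C ≤ C' := le_max_left _ _
  have hm1 : C' ≤ max C' 1 := le_max_left _ _
  have hm2 : 1 ≤ max C' 1 := le_max_right _ _
  obtain ⟨hb1, hb2⟩ := hbn
  rw [mul_div_assoc] at hb1 hb2
  have hLl : 0 < L / ℓ := by positivity
  obtain ⟨hc1, hc2⟩ := abs_le.1 hCn
  have hx0 : 0 ≤ x := by linarith
  have hfl1 : (⌊x⌋₊ : ℝ) ≤ x := Nat.floor_le hx0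
  have hfl2 : x < (⌊x⌋₊ : ℝ) + 1 := Nat.lt_floor_add_one x
  have hLn : L / ℓ ≤ n / 60 := by
    rw [div_le_iff₀ hlb]; linarith
  have ulo : (1/20) * (L / ℓ) ≤ u := by linarith
  have uhi : (u:ℝ) ≤ 30 * (L / ℓ) := by linarith
  have alo : (1/20) * (L / ℓ) ≤ a n := by linarith
  have ahi : (a n:ℝ) ≤ 30 * (L / ℓ) := by linarith
  have hun : u ≤ n := by
    have : (u:ℝ) ≤ n := by linarith
    exact_mod_cast this
  have han : a n ≤ n := by
    have : (a n:ℝ) ≤ n := by linarith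
    exact_mod_cast this
  obtain ⟨t, ht1, ht2, ht3⟩ := choose_ratio_int n (a n) u ((1/20) / ℓ * (L / n)) (60 / ℓ * (L / n))
    (by positivity) (by gcongr; norm_num) hun han (by
      intro i hi1 hi2
      have hi1' : (1/20) * (L / ℓ) ≤ i := by
        rcases min_le_iff.1 hi1 with h | h
        · have : (a n : ℝ) ≤ i := by exact_mod_cast h
          linarith
        · have : (u : ℝ) ≤ i := by exact_mod_cast h
          linarith
      have hi2' : (i:ℝ) + 1 ≤ 30 * (L / ℓ) := by
        rcases lt_max_iff.1 hi2 with h | h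
        · have : (i : ℝ) + 1 ≤ a n := by exact_mod_cast h
          linarith
        · have : (i : ℝ) + 1 ≤ u := by exact_mod_cast h
          linarith
      have hni : (n:ℝ) / 2 ≤ n - i := by linarith
      have hni0 : (0:ℝ) < n - i := by linarith
      constructor
      · rw [le_div_iff₀ hni0]
        calc (1/20) / ℓ * (L / n) * (n - i) ≤ (1/20) / ℓ * (L / n) * n := by
              gcongr
              have : (0:ℝ) ≤ i := Nat.cast_nonneg i
              linarith
          _ = (1/20) * (L / ℓ) := by field_simp
          _ ≤ _ := by linarith
      · rw [div_le_iff₀ hni0]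
        calc (i:ℝ) + 1 ≤ 30 * (L / ℓ) := hi2'
          _ = 60 / ℓ * (L / n) * (n / 2) := by field_simp; norm_num
          _ ≤ _ := by gcongr)
  have hsplit : b ^ ((a n : ℝ) - 1/2) = (n : ℝ)^2 / L^2 * K * b ^ ((a n : ℝ) - x - 1/2) := by
    rw [← hrp n hn1, ← Real.rpow_add hb0]
    congr 1
    ring
  have hn0 : (0:ℝ) < n := by linarith
  have hnL : (0:ℝ) < n / L := by positivity
  refine ⟨t * (n / L) * K * b ^ ((a n : ℝ) - x - 1/2), ?_, ?_, ?_⟩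
  · have h1 : (1/20) / ℓ ≤ t * (n / L) := by
      calc (1/20) / ℓ = (1/20) / ℓ * (L / n) * (n / L) := by field_simp
        _ ≤ _ := by gcongr
    have : 0 < t := lt_of_lt_of_le (by positivity) ht1
    gcongr
    · exact hb.le
    · linarith
  · have h1 : t * (n / L) ≤ 60 / ℓ := by
      calc t * (n / L) ≤ 60 / ℓ * (L / n) * (n / L) := by gcongr
        _ = _ := by field_simp
    gcongr
    · exact hb.le
    · linarith
  · have e : t * (n / L) * K * b ^ ((a n : ℝ) - x - 1/2) * (n / L) *
        b ^ (-(((a n : ℝ) - (u : ℝ)) / 2))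
        = t * (b ^ ((a n : ℝ) - 1/2) * b ^ (-(((a n : ℝ) - (u : ℝ)) / 2))) := by
      rw [hsplit]
      field_simp
    rw [e, mul_zpow, ht3, hqp (a n) u]
    ring
end
end

section
/- Let 0 < p < 1 be fixed and m = ⌊pN⌋. Let κ = κ(n) be a sequence of (complete or partial) colouring profiles such that κ_u = 0 for all u < 0.1·α and all u > 10·α, and such that Σ_u κ_u·(α−u)^2 = O(1). Then E_m[X̄_κ] and E_p[X̄_κ] both equal exp( φ(κ)·n + O(n·ln ln n / ln n) ), where φ(κ) = −(1−κ)·ln(1−κ) + (ln b / 2)·Σ_u κ_u·(α_0 − 1 − 2/ln b − u), κ = Σ_u κ_u, and (1−κ)ln(1−κ) is interpreted as 0 when κ = 1. -/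
open Filter
open scoped BigOperators Classical

noncomputable section

/-! ### Counting tuples of disjoint sets -/

lemma count_tuples {α : Type*} [DecidableEq α] (k : ℕ) : ∀ (s : Fin k → ℕ) (W : Finset α),
    ∑ i, s i ≤ W.card →
    ((Fintype.piFinset (fun _ : Fin k => W.powerset)).filter
      (fun V => (∀ i j, i ≠ j → Disjoint (V i) (V j)) ∧ ∀ i, (V i).card = s i)).card *
      ((∏ i, (s i).factorial) * (W.card - ∑ i, s i).factorial) = W.card.factorial := by
  induction k with
  | zero =>
    intro s W _
    simp
  | succ k ih =>
    intro s W hs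
    rw [Fin.sum_univ_succ] at hs
    rw [Finset.card_eq_sum_card_fiberwise (f := fun V => V 0) (t := W.powersetCard (s 0))]
    · have key : ∀ A ∈ W.powersetCard (s 0),
          (((Fintype.piFinset (fun _ : Fin (k+1) => W.powerset)).filter
            (fun V => (∀ i j, i ≠ j → Disjoint (V i) (V j)) ∧ ∀ i, (V i).card = s i)).filter
              (fun V => V 0 = A)).card *
            ((∏ i, (s (Fin.succ i)).factorial) * (W.card - ∑ i, s i).factorial) =
            (W.card - s 0).factorial := by
        intro A hA
        rw [Finset.mem_powersetCard] at hA
        have hWA : (W \ A).card = W.card - s 0 := by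
          rw [Finset.card_sdiff_of_subset hA.1, hA.2]
        have h := ih (fun i => s i.succ) (W \ A) (by rw [hWA]; omega)
        rw [hWA] at h
        rw [← h]
        congr 1
        · apply Finset.card_nbij' (fun V i => V (Fin.succ i)) (fun V => Fin.cons A V)
          · intro V hV
            simp only [Finset.coe_filter, Set.mem_ofPred_eq, Fintype.mem_piFinset,
              Finset.mem_powerset, Finset.mem_filter] at hV ⊢
            obtain ⟨⟨h1, h2, h3⟩, h4⟩ := hV
            refine ⟨fun i => ?_, fun i j hij => h2 _ _ (by simpa using hij), fun i => h3 _⟩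
            rw [Finset.subset_sdiff]
            refine ⟨h1 _, ?_⟩
            rw [← h4]
            exact h2 _ _ (Fin.succ_ne_zero i)
          · intro V hV
            simp only [Finset.coe_filter, Set.mem_ofPred_eq, Fintype.mem_piFinset,
              Finset.mem_powerset, Finset.mem_filter] at hV ⊢
            obtain ⟨h1, h2, h3⟩ := hV
            simp only [Finset.subset_sdiff] at h1
            refine ⟨⟨fun i => ?_, fun i j => ?_, fun i => ?_⟩, by simp⟩
            · refine Fin.cases ?_ (fun i => ?_) i
              · simpa using hA.1
              · simpa using (h1 i).1
            · refine Fin.cases ?_ (fun i => ?_) i <;> refine Fin.cases ?_ (fun j => ?_) j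
              · simp
              · intro _; simpa using (h1 j).2.symm
              · intro _; simpa using (h1 i).2
              · intro hij; simpa using h2 i j (by simpa using hij)
            · refine Fin.cases ?_ (fun i => ?_) i
              · simpa using hA.2
              · simpa using h3 i
          · intro V hV
            simp only [Finset.coe_filter, Set.mem_ofPred_eq, Finset.mem_filter] at hV
            funext i
            refine Fin.cases ?_ (fun i => ?_) i
            · simpa using hV.2.symm
            · simp
          · intro V hV
            funext i
            simp
        · congr 2
          rw [Fin.sum_univ_succ]; omega
      rw [Fin.prod_univ_succ, Finset.sum_mul]
      have : ∀ A ∈ W.powersetCard (s 0),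
          (((Fintype.piFinset (fun _ : Fin (k+1) => W.powerset)).filter
            (fun V => (∀ i j, i ≠ j → Disjoint (V i) (V j)) ∧ ∀ i, (V i).card = s i)).filter
              (fun V => V 0 = A)).card *
            ((s 0).factorial * (∏ i, (s (Fin.succ i)).factorial) *
              (W.card - ∑ i, s i).factorial) =
            (s 0).factorial * (W.card - s 0).factorial := by
        intro A hA
        rw [← key A hA]; ring
      rw [Finset.sum_congr rfl this, Finset.sum_const, Finset.card_powersetCard, smul_eq_mul,
        ← mul_assoc]
      exact Nat.choose_mul_factorial_mul_factorial (by omega)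
    · intro V hV
      simp only [Finset.coe_filter, Set.mem_ofPred_eq, Fintype.mem_piFinset,
              Finset.mem_powerset] at hV
      simp only [Finset.mem_coe, Finset.mem_powersetCard]
      exact ⟨hV.1 0, hV.2.2 0⟩

lemma ofFn_perm_of_counts {k : ℕ} {s t : Fin k → ℕ}
    (h : ∀ u : ℕ, (Finset.univ.filter fun i => s i = u).card =
      (Finset.univ.filter fun i => t i = u).card) : (List.ofFn s).Perm (List.ofFn t) := by
  rw [← Multiset.coe_eq_coe, ← Fin.univ_val_map, ← Fin.univ_val_map]
  ext u
  rw [Multiset.count_map, Multiset.count_map]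
  have := h u
  simp only [Finset.card_def, Finset.filter_val] at this
  simpa [eq_comm] using this

lemma antitone_unique {k : ℕ} {s t : Fin k → ℕ} (hs : Antitone s) (ht : Antitone t)
    (h : ∀ u : ℕ, (Finset.univ.filter fun i => s i = u).card =
      (Finset.univ.filter fun i => t i = u).card) : s = t := by
  have := List.Perm.eq_of_sortedGE (List.sortedGE_ofFn_iff.2 hs) (List.sortedGE_ofFn_iff.2 ht)
    (ofFn_perm_of_counts h)
  exact List.ofFn_injective this

lemma antitone_exists {n k : ℕ} {P : ℕ → ℕ} (h : IsProfile n k P) :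
    ∃ s : Fin k → ℕ, Antitone s ∧
      ∀ u : ℕ, (Finset.univ.filter fun i => s i = u).card = P u := by
  obtain ⟨h1, h2, h3⟩ := h
  set M : Multiset ℕ := ∑ u ∈ Finset.Icc 1 n, Multiset.replicate (P u) u with hM
  have hcard : (M.sort (· ≥ ·)).length = k := by
    simp [hM, h2]
  subst hcard
  refine ⟨fun i => (M.sort (· ≥ ·)).get i, ?_, fun u => ?_⟩
  · have : (M.sort (· ≥ ·)).SortedGE := (Multiset.pairwise_sort M (· ≥ ·)).sortedGE
    intro i j hij
    exact this.antitone_get hij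
  · have h4 : Multiset.count u M = P u := by
      rw [hM, Multiset.count_sum']
      simp only [Multiset.count_replicate]
      rw [Finset.sum_ite_eq' ]
      split_ifs with hu
      · rfl
      · exact (h1 u hu).symm
    have h5 : Multiset.map (fun i => (M.sort (· ≥ ·)).get i) Finset.univ.val = M := by
      rw [Fin.univ_val_map, List.ofFn_get, Multiset.sort_eq]
    rw [← h4]
    conv_rhs => rw [← h5]
    rw [Multiset.count_map, Finset.card_def, Finset.filter_val]
    simp [eq_comm]

/-- The structurally valid tuples. -/
def tuples (n : ℕ) (P : ℕ → ℕ) : Finset (Fin (profileParts n P) → Finset (Fin n)) :=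
  Finset.univ.filter fun V => (∀ i j, i ≠ j → Disjoint (V i) (V j)) ∧
    (∀ i j, i ≤ j → (V j).card ≤ (V i).card) ∧
    (∀ u : ℕ, (Finset.univ.filter fun i => (V i).card = u).card = P u)

lemma sum_over_sizes {n k : ℕ} {P : ℕ → ℕ} (h : IsProfile n k P) {s : Fin k → ℕ}
    (hs : ∀ u : ℕ, (Finset.univ.filter fun i => s i = u).card = P u) (f : ℕ → ℕ) :
    ∑ i, f (s i) = ∑ u ∈ Finset.Icc 1 n, P u * f u := by
  rw [← Finset.sum_fiberwise_of_maps_to (t := Finset.Icc 1 n) (g := s)]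
  · apply Finset.sum_congr rfl
    intro u _
    rw [← hs u, Finset.sum_congr rfl (g := fun _ => f u)]
    · simp
    · intro i hi
      simp at hi
      rw [hi]
  · intro i _
    by_contra hu
    have := h.1 _ hu
    rw [← hs, Finset.card_eq_zero] at this
    have : i ∈ (∅ : Finset (Fin k)) := by rw [← this]; simp
    simp at this

lemma prod_over_sizes {n k : ℕ} {P : ℕ → ℕ} (h : IsProfile n k P) {s : Fin k → ℕ}
    (hs : ∀ u : ℕ, (Finset.univ.filter fun i => s i = u).card = P u) (f : ℕ → ℕ) :
    ∏ i, f (s i) = ∏ u ∈ Finset.Icc 1 n, f u ^ P u := by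
  rw [← Finset.prod_fiberwise_of_maps_to (t := Finset.Icc 1 n) (g := s)]
  · apply Finset.prod_congr rfl
    intro u _
    rw [← hs u, Finset.prod_congr rfl (g := fun _ => f u)]
    · simp
    · intro i hi
      simp at hi
      rw [hi]
  · intro i _
    by_contra hu
    have := h.1 _ hu
    rw [← hs, Finset.card_eq_zero] at this
    have : i ∈ (∅ : Finset (Fin k)) := by rw [← this]; simp
    simp at this

lemma card_tuples {n : ℕ} {P : ℕ → ℕ} (h : IsProfile n (profileParts n P) P) :
    (tuples n P).card * ((∏ u ∈ Finset.Icc 1 n, u.factorial ^ P u) *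
      (n - ∑ u ∈ Finset.Icc 1 n, u * P u).factorial) = n.factorial := by
  obtain ⟨s, hs1, hs2⟩ := antitone_exists h
  have hsum : ∑ i, s i = ∑ u ∈ Finset.Icc 1 n, u * P u := by
    rw [sum_over_sizes h hs2 (fun u => u)]
    exact Finset.sum_congr rfl fun u _ => mul_comm _ _
  have := count_tuples _ s (Finset.univ : Finset (Fin n)) (by
    rw [hsum, Finset.card_univ, Fintype.card_fin]; exact h.2.2)
  rw [hsum, prod_over_sizes h hs2 Nat.factorial, Finset.card_univ, Fintype.card_fin] at this
  rw [← this]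
  congr 2
  ext V
  simp only [tuples, Finset.mem_filter, Finset.mem_univ, true_and, Fintype.mem_piFinset,
    Finset.mem_powerset, Finset.subset_univ, implies_true]
  refine and_congr_right fun _ => ⟨fun h1 => ?_, fun h1 => ?_⟩
  · have : (fun i => (V i).card) = s := antitone_unique (fun i j hij => h1.1 i j hij) hs1
      (fun u => by rw [hs2 u]; exact h1.2 u)
    exact fun i => congrFun this i
  · simp only [h1]
    exact ⟨fun i j hij => hs1 hij, hs2⟩

/-! ### Expectations -/

/-- All potential edges. -/
def allEdges (n : ℕ) : Finset (Sym2 (Fin n)) := Finset.univ.filter fun e => ¬ e.IsDiag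

lemma card_allEdges (n : ℕ) : (allEdges n).card = n.choose 2 := by
  have := Sym2.card_subtype_not_diag (α := Fin n)
  rw [Fintype.card_fin] at this
  rw [← this, Fintype.card_subtype]
  unfold allEdges
  congr

/-- Edge finset, classically. -/
def eF {n : ℕ} (G : SimpleGraph (Fin n)) : Finset (Sym2 (Fin n)) :=
  Finset.univ.filter fun e => e ∈ G.edgeSet

lemma card_eF {n : ℕ} (G : SimpleGraph (Fin n)) : (eF G).card = edgeCount G := by
  unfold eF edgeCount
  rw [Nat.card_eq_fintype_card, Fintype.card_subtype]

lemma eF_subset {n : ℕ} (G : SimpleGraph (Fin n)) : eF G ⊆ allEdges n := by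
  intro e he
  simp only [eF, allEdges, Finset.mem_filter, Finset.mem_univ, true_and] at he ⊢
  exact G.not_isDiag_of_mem_edgeSet he

lemma sum_graphs {n : ℕ} (f : Finset (Sym2 (Fin n)) → ℝ) :
    ∑ G : SimpleGraph (Fin n), f (eF G) = ∑ E ∈ (allEdges n).powerset, f E := by
  apply Finset.sum_nbij' (fun G => eF G)
    (fun E => SimpleGraph.fromEdgeSet (E : Set (Sym2 (Fin n))))
  · intro G _
    rw [Finset.mem_powerset]; exact eF_subset G
  · intro E _; simp
  · intro G _
    have : ((eF G : Finset _) : Set (Sym2 (Fin n))) = G.edgeSet := by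
      ext e; simp [eF]
    rw [this, SimpleGraph.fromEdgeSet_edgeSet]
  · intro E hE
    rw [Finset.mem_powerset] at hE
    ext e
    simp only [eF, SimpleGraph.edgeSet_fromEdgeSet, Finset.mem_filter, Finset.mem_univ, true_and,
      Set.mem_sdiff, Finset.mem_coe]
    constructor
    · exact fun h => h.1
    · intro h
      refine ⟨h, ?_⟩
      have := hE h
      simpa [allEdges] using this
  · intro G _; rfl

/-- Edges inside the parts. -/
def innerE {n k : ℕ} (V : Fin k → Finset (Fin n)) : Finset (Sym2 (Fin n)) :=
  Finset.univ.biUnion fun i => (V i).offDiag.image (fun x => s(x.1, x.2))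

lemma inner_subset {n k : ℕ} (V : Fin k → Finset (Fin n)) : innerE V ⊆ allEdges n := by
  intro e he
  simp only [innerE, Finset.mem_biUnion, Finset.mem_image, Finset.mem_offDiag] at he
  obtain ⟨i, _, x, ⟨_, _, hx⟩, rfl⟩ := he
  simpa [allEdges] using hx

lemma card_inner {n k : ℕ} (V : Fin k → Finset (Fin n))
    (hV : ∀ i j, i ≠ j → Disjoint (V i) (V j)) :
    (innerE V).card = ∑ i, (V i).card.choose 2 := by
  unfold innerE
  rw [Finset.card_biUnion]
  · exact Finset.sum_congr rfl fun i _ => Sym2.card_image_offDiag _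
  · intro i _ j _ hij
    rw [Function.onFun, Finset.disjoint_left]
    intro e he he'
    simp only [Finset.mem_image, Finset.mem_offDiag] at he he'
    obtain ⟨⟨a, b⟩, ⟨h1, h2, h3⟩, rfl⟩ := he
    obtain ⟨⟨c, d⟩, ⟨h4, h5, h6⟩, h7⟩ := he'
    have hd := Finset.disjoint_left.1 (hV i j hij)
    rcases Sym2.eq_iff.1 h7 with ⟨rfl, rfl⟩ | ⟨rfl, rfl⟩
    · exact hd h1 h4
    · exact hd h1 h5

lemma indep_iff {n k : ℕ} (G : SimpleGraph (Fin n)) (V : Fin k → Finset (Fin n)) :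
    (∀ i, IndepFinset G (V i)) ↔ Disjoint (eF G) (innerE V) := by
  rw [Finset.disjoint_left]
  constructor
  · intro h e he he'
    simp only [innerE, Finset.mem_biUnion, Finset.mem_image, Finset.mem_offDiag] at he'
    obtain ⟨i, _, ⟨a, b⟩, ⟨h1, h2, hx⟩, rfl⟩ := he'
    simp only [eF, Finset.mem_filter] at he
    exact h i a h1 b h2 he.2
  · intro h i v hv w hw hvw
    refine h (a := s(v, w)) (by simpa [eF] using hvw) ?_
    simp only [innerE, Finset.mem_biUnion, Finset.mem_image, Finset.mem_offDiag]
    exact ⟨i, Finset.mem_univ _, (v, w), ⟨hv, hw, hvw.ne⟩, rfl⟩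

lemma Xprofile_eq {n : ℕ} (G : SimpleGraph (Fin n)) (P : ℕ → ℕ) :
    (Xprofile G P : ℝ) = ∑ V ∈ tuples n P, if Disjoint (eF G) (innerE V) then (1:ℝ) else 0 := by
  unfold Xprofile
  rw [Finset.sum_boole, Nat.cast_inj, ← Set.ncard_coe_finset]
  congr 1
  ext V
  simp only [Set.mem_ofPred_eq, Finset.coe_filter, tuples, Finset.mem_filter, Finset.mem_univ,
    true_and, ← indep_iff]
  tauto

lemma card_inner_tuples {n : ℕ} {P : ℕ → ℕ} (h : IsProfile n (profileParts n P) P)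
    {V : Fin (profileParts n P) → Finset (Fin n)} (hV : V ∈ tuples n P) :
    (innerE V).card = ∑ u ∈ Finset.Icc 1 n, P u * u.choose 2 := by
  simp only [tuples, Finset.mem_filter, Finset.mem_univ, true_and] at hV
  rw [card_inner V hV.1, sum_over_sizes h hV.2.2 (fun u => u.choose 2)]

lemma filter_disjoint_powerset {n : ℕ} (S : Finset (Sym2 (Fin n))) :
    (allEdges n).powerset.filter (fun E => Disjoint E S) = (allEdges n \ S).powerset := by
  ext E
  simp [Finset.subset_sdiff]

lemma prob_p {n : ℕ} (p : ℝ) (S : Finset (Sym2 (Fin n))) (hS : S ⊆ allEdges n) :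
    ∑ E ∈ (allEdges n).powerset, (if Disjoint E S then (1:ℝ) else 0) *
      (p ^ E.card * (1 - p) ^ (n.choose 2 - E.card)) = (1 - p) ^ S.card := by
  simp only [ite_mul, one_mul, zero_mul]
  rw [← Finset.sum_filter, filter_disjoint_powerset]
  have hc : (allEdges n \ S).card = n.choose 2 - S.card := by
    rw [Finset.card_sdiff_of_subset hS, card_allEdges]
  have hle : S.card ≤ n.choose 2 := by
    rw [← card_allEdges]; exact Finset.card_le_card hS
  have : ∀ E ∈ (allEdges n \ S).powerset, p ^ E.card * (1 - p) ^ (n.choose 2 - E.card) =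
      (1 - p) ^ S.card * (p ^ E.card * (1 - p) ^ ((allEdges n \ S).card - E.card)) := by
    intro E hE
    rw [Finset.mem_powerset] at hE
    have := Finset.card_le_card hE
    rw [hc] at this ⊢
    rw [show n.choose 2 - E.card = S.card + (n.choose 2 - S.card - E.card) by omega, pow_add]
    ring
  rw [Finset.sum_congr rfl this, ← Finset.mul_sum, Finset.sum_pow_mul_eq_add_pow]
  simp

/-- The number of tuples (unordered). -/
def cnt (n : ℕ) (P : ℕ → ℕ) : ℝ :=
  ((tuples n P).card : ℝ) / ∏ u ∈ Finset.Icc 1 n, ((P u).factorial : ℝ)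

/-- The number of forbidden edges. -/
def Fb (n : ℕ) (P : ℕ → ℕ) : ℕ := ∑ u ∈ Finset.Icc 1 n, P u * u.choose 2

lemma Ep_eq {n : ℕ} (p : ℝ) {P : ℕ → ℕ} (h : IsProfile n (profileParts n P) P) :
    Ep n p (fun G => Xbar G P) = cnt n P * (1 - p) ^ Fb n P := by
  unfold Ep Xbar cnt
  rw [finsum_eq_sum_of_fintype]
  simp only [Xprofile_eq, ← card_eF]
  rw [sum_graphs (fun E => (∑ V ∈ tuples n P, if Disjoint E (innerE V) then (1:ℝ) else 0) /
    (∏ u ∈ Finset.Icc 1 n, ((P u).factorial : ℝ)) * p ^ E.card *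
      (1 - p) ^ (n.choose 2 - E.card))]
  have : ∀ E ∈ (allEdges n).powerset,
    (∑ V ∈ tuples n P, if Disjoint E (innerE V) then (1:ℝ) else 0) /
    (∏ u ∈ Finset.Icc 1 n, ((P u).factorial : ℝ)) * p ^ E.card *
      (1 - p) ^ (n.choose 2 - E.card) =
    (∏ u ∈ Finset.Icc 1 n, ((P u).factorial : ℝ))⁻¹ * ∑ V ∈ tuples n P,
      (if Disjoint E (innerE V) then (1:ℝ) else 0) *
      (p ^ E.card * (1 - p) ^ (n.choose 2 - E.card)) := by
    intro E _
    rw [← Finset.sum_mul]; field_simp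
  rw [Finset.sum_congr rfl this, ← Finset.mul_sum, Finset.sum_comm]
  have : ∀ V ∈ tuples n P, ∑ E ∈ (allEdges n).powerset,
      (if Disjoint E (innerE V) then (1:ℝ) else 0) *
      (p ^ E.card * (1 - p) ^ (n.choose 2 - E.card)) = (1 - p) ^ Fb n P := by
    intro V hV
    rw [prob_p p _ (inner_subset V), card_inner_tuples h hV]; rfl
  rw [Finset.sum_congr rfl this]
  simp only [Finset.sum_const, nsmul_eq_mul]
  field_simp

lemma sum_graphs_m {n : ℕ} (m : ℕ) (f : Finset (Sym2 (Fin n)) → ℝ) :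
    ∑ G : {G : SimpleGraph (Fin n) // edgeCount G = m}, f (eF G.1) =
      ∑ E ∈ (allEdges n).powersetCard m, f E := by
  have h1 : ∑ G : {G : SimpleGraph (Fin n) // edgeCount G = m}, f (eF G.1) =
      ∑ G : SimpleGraph (Fin n), (fun E => if E.card = m then f E else 0) (eF G) := by
    simp only [card_eF]
    rw [← Finset.sum_filter]
    rw [Finset.sum_subtype (p := fun G => edgeCount G = m)]
    intro x; simp
  rw [h1, sum_graphs (fun E => if E.card = m then f E else 0), ← Finset.sum_filter]
  congr 1
  ext E
  simp [Finset.mem_powersetCard]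

lemma card_graphs_m (n m : ℕ) :
    (Nat.card {G : SimpleGraph (Fin n) // edgeCount G = m} : ℝ) = ((n.choose 2).choose m : ℝ) := by
  have := sum_graphs_m (n := n) m (fun _ => 1)
  simp only [Finset.sum_const, Finset.card_powersetCard, card_allEdges, nsmul_eq_mul, mul_one] at this
  rw [← this, Nat.card_eq_fintype_card, Finset.card_univ]

lemma Em_eq {n : ℕ} (m : ℕ) {P : ℕ → ℕ} (h : IsProfile n (profileParts n P) P) :
    Em n m (fun G => Xbar G P) =
      cnt n P * (((n.choose 2 - Fb n P).choose m : ℝ) / ((n.choose 2).choose m : ℝ)) := by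
  unfold Em Xbar cnt
  rw [finsum_eq_sum_of_fintype, card_graphs_m]
  simp only [Xprofile_eq]
  rw [sum_graphs_m m (fun E => (∑ V ∈ tuples n P, if Disjoint E (innerE V) then (1:ℝ) else 0) /
    (∏ u ∈ Finset.Icc 1 n, ((P u).factorial : ℝ)))]
  rw [← Finset.sum_div, Finset.sum_comm]
  have : ∀ V ∈ tuples n P, ∑ E ∈ (allEdges n).powersetCard m,
      (if Disjoint E (innerE V) then (1:ℝ) else 0) = ((n.choose 2 - Fb n P).choose m : ℝ) := by
    intro V hV
    rw [Finset.sum_boole]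
    have h1 : ((allEdges n).powersetCard m).filter (fun E => Disjoint E (innerE V)) =
        (allEdges n \ innerE V).powersetCard m := by
      ext E
      simp only [Finset.mem_filter, Finset.mem_powersetCard, Finset.subset_sdiff]
      tauto
    rw [h1, Finset.card_powersetCard, Finset.card_sdiff_of_subset (inner_subset V),
      card_inner_tuples h hV, card_allEdges]
    rfl
  rw [Finset.sum_congr rfl this]
  simp only [Finset.sum_const, nsmul_eq_mul]
  ring

/-! ### Analysis -/

lemma log_fact_lower (n : ℕ) : (n:ℝ) * Real.log n - n ≤ Real.log (n.factorial : ℝ) := by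
  rcases Nat.eq_zero_or_pos n with rfl | hn
  · simp
  · have := Stirling.le_log_factorial_stirling hn.ne'
    have h1 : 0 ≤ Real.log n := Real.log_natCast_nonneg n
    have h2 : 0 ≤ Real.log (2 * Real.pi) :=
      Real.log_nonneg (by nlinarith [Real.pi_gt_three])
    linarith

lemma log_fact_upper (n : ℕ) :
    Real.log (n.factorial : ℝ) ≤ (n:ℝ) * Real.log n - n + Real.log n + 1 := by
  induction n with
  | zero => simp
  | succ n ih =>
    rcases Nat.eq_zero_or_pos n with rfl | hn
    · simp
    · have hn' : (0:ℝ) < n := by exact_mod_cast hn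
      rw [Nat.factorial_succ]
      push_cast
      rw [Real.log_mul (by positivity) (by positivity)]
      have h1 : 1 - ((n+1:ℝ)/n)⁻¹ ≤ Real.log ((n+1:ℝ)/n) :=
        Real.one_sub_inv_le_log_of_pos (by positivity)
      rw [Real.log_div (by positivity) (by positivity), inv_div] at h1
      have h2 : 1 - (n:ℝ)/(n+1) = 1/(n+1) := by field_simp; ring
      rw [h2, div_le_iff₀ (by positivity)] at h1
      nlinarith

lemma log_cnt {n : ℕ} {P : ℕ → ℕ} (h : IsProfile n (profileParts n P) P) :
    0 < cnt n P ∧ Real.log (cnt n P) = Real.log (n.factorial : ℝ) -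
      Real.log ((n - ∑ u ∈ Finset.Icc 1 n, u * P u).factorial : ℝ) -
      ∑ u ∈ Finset.Icc 1 n, (P u : ℝ) * Real.log (u.factorial : ℝ) -
      ∑ u ∈ Finset.Icc 1 n, Real.log ((P u).factorial : ℝ) := by
  have h1 := card_tuples h
  have hpos : 0 < (tuples n P).card := by
    rcases Nat.eq_zero_or_pos (tuples n P).card with h0 | h0
    · rw [h0, zero_mul] at h1
      exact absurd h1.symm (Nat.factorial_ne_zero n)
    · exact h0
  have hpos' : (0:ℝ) < (tuples n P).card := by exact_mod_cast hpos
  have hprod : (0:ℝ) < ∏ u ∈ Finset.Icc 1 n, ((P u).factorial : ℝ) :=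
    Finset.prod_pos fun u _ => by positivity
  have hprod2 : (0:ℝ) < ∏ u ∈ Finset.Icc 1 n, (u.factorial : ℝ) ^ P u :=
    Finset.prod_pos fun u _ => by positivity
  refine ⟨div_pos hpos' hprod, ?_⟩
  have h2 := congrArg (fun x : ℕ => Real.log (x : ℝ)) h1
  simp only [Nat.cast_mul, Nat.cast_prod, Nat.cast_pow] at h2
  rw [Real.log_mul hpos'.ne' (by positivity), Real.log_mul hprod2.ne' (by positivity),
    Real.log_prod (fun u _ => by positivity)] at h2
  simp only [Real.log_pow] at h2
  unfold cnt
  rw [Real.log_div hpos'.ne' hprod.ne', Real.log_prod (fun u _ => by positivity), ← h2]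
  ring

lemma log_choose_ratio (N m : ℕ) (q : ℝ) (hq : 0 < q) (hq1 : q < 1)
    (hN : 0 < N) (hm1 : q * N ≤ (N:ℝ) - m) (hm2 : (N:ℝ) - m ≤ q * N + 1) (F0 : ℕ)
    (hF0 : 4 * (1 + (F0:ℝ)) ≤ q * N) (F : ℕ) (hF : F ≤ F0) :
    0 < (N - F).choose m ∧
    |Real.log ((N - F).choose m : ℝ) - Real.log (N.choose m : ℝ) - F * Real.log q| ≤
      F * (4 * (1 + (F0:ℝ)) / (q * N)) := by
  have hN' : (0:ℝ) < N := by exact_mod_cast hN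
  have hqN : 0 < q * N := by positivity
  have hqN1 : q * N ≤ N := by nlinarith
  induction F with
  | zero =>
    have : m ≤ N := by
      have : (m:ℝ) ≤ N := by linarith
      exact_mod_cast this
    simpa using Nat.choose_pos this
  | succ F ih =>
    obtain ⟨ih1, ih2⟩ := ih (by omega)
    have hFr : (F:ℝ) + 1 ≤ F0 := by exact_mod_cast hF
    have hF0' : (0:ℝ) ≤ F := Nat.cast_nonneg F
    have hFN : F + 1 ≤ N := by
      have : (F:ℝ) + 1 ≤ N := by linarith
      exact_mod_cast this
    have hmN : m + F + 1 ≤ N := by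
      have : (m:ℝ) + F + 1 ≤ N := by linarith
      exact_mod_cast this
    have hpos : 0 < (N - (F+1)).choose m := Nat.choose_pos (by omega)
    refine ⟨hpos, ?_⟩
    have h := Nat.choose_mul_succ_eq (N - (F+1)) m
    rw [show N - (F+1) + 1 = N - F by omega] at h
    have h' : ((N - (F+1)).choose m : ℝ) * ((N:ℝ) - F) =
        ((N - F).choose m : ℝ) * ((N:ℝ) - F - m) := by
      have h3 : ((N - F : ℕ) : ℝ) = (N:ℝ) - F := by
        rw [Nat.cast_sub (by omega)]
      have h4 : ((N - F - m : ℕ) : ℝ) = (N:ℝ) - F - m := by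
        rw [Nat.cast_sub (by omega), h3]
      rw [← h4, ← h3]
      exact_mod_cast h
    have hNF : (0:ℝ) < (N:ℝ) - F := by linarith
    have hNFm : (0:ℝ) < (N:ℝ) - F - m := by linarith
    have hl := congrArg Real.log h'
    have hp1 : (0:ℝ) < ((N - (F+1)).choose m : ℝ) := by exact_mod_cast hpos
    have hp2 : (0:ℝ) < ((N - F).choose m : ℝ) := by exact_mod_cast ih1
    rw [Real.log_mul hp1.ne' hNF.ne', Real.log_mul hp2.ne' hNFm.ne'] at hl
    -- the ratio
    set y : ℝ := ((N:ℝ) - F - m) / (q * ((N:ℝ) - F)) with hy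
    have hy0 : 0 < y := by positivity
    have hlog : Real.log y = Real.log ((N:ℝ) - F - m) - Real.log q - Real.log ((N:ℝ) - F) := by
      rw [hy, Real.log_div hNFm.ne' (by positivity), Real.log_mul hq.ne' hNF.ne']; ring
    have hNF2 : (N:ℝ)/2 ≤ (N:ℝ) - F := by linarith
    have hd : |y - 1| ≤ 2 * (1 + (F0:ℝ)) / (q * N) := by
      have e : y - 1 = ((N:ℝ) - F - m - q * (N - F)) / (q * ((N:ℝ) - F)) := by
        rw [hy]; field_simp
      rw [e, abs_div, abs_of_pos (show 0 < q * ((N:ℝ) - F) by positivity),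
        div_le_div_iff₀ (by positivity) hqN]
      have h5 : |(N:ℝ) - F - m - q * (N - F)| ≤ 1 + F0 := by
        rw [abs_le]; constructor <;> nlinarith
      have h6 : q * N ≤ 2 * (q * ((N:ℝ) - F)) := by nlinarith
      calc _ ≤ (1 + (F0:ℝ)) * (2 * (q * ((N:ℝ) - F))) := by
            apply mul_le_mul h5 h6 hqN.le (by positivity)
        _ = _ := by ring
    have hd2 : |y - 1| ≤ 1/2 := by
      refine hd.trans ?_
      rw [div_le_div_iff₀ hqN (by norm_num)]
      linarith
    have hly : |Real.log y| ≤ 2 * |y - 1| := by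
      have u1 := Real.log_le_sub_one_of_pos hy0
      have u2 := Real.one_sub_inv_le_log_of_pos hy0
      have u3 := abs_le.1 hd2
      have hyh : 1/2 ≤ y := by linarith
      have u4 : -(2 * |y-1|) ≤ 1 - y⁻¹ := by
        have : 1 - y⁻¹ = (y - 1) / y := by field_simp
        rw [this, le_div_iff₀ hy0]
        have := neg_abs_le (y-1)
        have := abs_nonneg (y-1)
        nlinarith
      rw [abs_le]
      constructor
      · linarith
      · have := le_abs_self (y-1)
        have := abs_nonneg (y-1)
        linarith
    have hfin : |Real.log y| ≤ 4 * (1 + (F0:ℝ)) / (q * N) := by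
      calc _ ≤ 2 * |y-1| := hly
        _ ≤ 2 * (2 * (1 + (F0:ℝ)) / (q * N)) := by linarith
        _ = _ := by ring
    have e2 : Real.log ((N - (F+1)).choose m : ℝ) - Real.log (N.choose m : ℝ) -
        ((F+1:ℕ):ℝ) * Real.log q =
        (Real.log ((N - F).choose m : ℝ) - Real.log (N.choose m : ℝ) - F * Real.log q) +
          Real.log y := by
      rw [hlog]; push_cast; linarith
    rw [e2]
    refine (abs_add_le _ _).trans ?_
    push_cast
    linarith

/-- The quadratic-type estimate for one class size. -/
lemma class_err {c L u B : ℝ} (hc : 0 < c) (hL : 0 < L) (hu : 0 < u) (huB : u ≤ B * L) :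
    |u * (Real.log (2 * L / c) - Real.log u - L / u + c / 2)| ≤
      (1 + c * B / 2 + c / 2) * |u - 2 * L / c| := by
  set r := 2 * L / (c * u) with hr
  have hr0 : 0 < r := by positivity
  have hlog : Real.log (2 * L / c) - Real.log u = Real.log r := by
    rw [← Real.log_div (by positivity) (by positivity), div_div]
  have hLu : L / u = c / 2 * r := by rw [hr]; field_simp
  have h1 : u * |r - 1| = |u - 2 * L / c| := by
    have : u * (r - 1) = -(u - 2 * L / c) := by rw [hr]; field_simp; ring
    calc u * |r-1| = |u * (r-1)| := by rw [abs_mul, abs_of_pos hu]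
      _ = _ := by rw [this, abs_neg]
  have hinv : r⁻¹ ≤ c * B / 2 := by
    rw [hr, inv_div, div_le_iff₀ (by positivity)]
    nlinarith
  have hinv0 : 0 < r⁻¹ := by positivity
  have h2 : |Real.log r| ≤ (1 + c * B / 2) * |r - 1| := by
    have u1 := Real.log_le_sub_one_of_pos hr0
    have u2 := Real.one_sub_inv_le_log_of_pos hr0
    have u3 : 1 - r⁻¹ = r⁻¹ * (r - 1) := by field_simp
    have u4 : -(r⁻¹ * |r-1|) ≤ r⁻¹ * (r-1) := by
      have := neg_abs_le (r-1)
      nlinarith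
    have u5 : r⁻¹ * |r-1| ≤ c * B / 2 * |r-1| :=
      mul_le_mul_of_nonneg_right hinv (abs_nonneg _)
    have u6 := le_abs_self (r-1)
    have u7 := abs_nonneg (r-1)
    have u8 : 0 ≤ c * B / 2 * |r-1| := mul_nonneg (hinv0.le.trans hinv) u7
    rw [abs_le]; constructor <;> linarith
  rw [hlog, hLu, abs_mul, abs_of_pos hu, ← h1]
  have h3 : |Real.log r - c / 2 * r + c / 2| ≤ (1 + c * B / 2 + c / 2) * |r - 1| := by
    have : Real.log r - c / 2 * r + c / 2 = Real.log r - c / 2 * (r - 1) := by ring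
    rw [this]
    refine (abs_sub _ _).trans ?_
    rw [abs_mul, abs_of_pos (show 0 < c/2 by positivity)]
    linarith
  calc _ ≤ u * ((1 + c * B / 2 + c / 2) * |r - 1|) := mul_le_mul_of_nonneg_left h3 hu.le
    _ = _ := by ring

set_option maxHeartbeats 2000000 in
lemma main_est {n : ℕ} {P : ℕ → ℕ} (h : IsProfile n (profileParts n P) P)
    {c A B D L LL : ℝ} (hc : 0 < c) (hA : 0 < A) (hB : 0 < B)
    (hn : 0 < n) (hLdef : L = Real.log n) (hLL : LL = Real.log L) (hL1 : 1 ≤ L) (hLL1 : 1 ≤ LL)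
    (hbig : L + 1 ≤ n / L)
    (hsupp : ∀ u, P u ≠ 0 → A * L ≤ u ∧ (u:ℝ) ≤ B * L)
    (hmom : ∑ u ∈ Finset.Icc 1 n, ((u:ℝ) * P u) * |(u:ℝ) - 2 * L / c| ≤ D * LL * n) :
    |Real.log (cnt n P) - c * Fb n P - (-((n:ℝ) * (1 - kappaTot n P)) *
        Real.log (1 - kappaTot n P) + ∑ u ∈ Finset.Icc 1 n,
          ((u:ℝ) * P u) * (L - Real.log (2 * L / c) - c / 2 * u))| ≤
      (2 + (|Real.log B| + 2) / A + (3 / A + B) + (1 + c * B / 2 + c / 2) / A * D)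
        * (n * LL / L) := by
  have hL0 : 0 < L := by linarith
  have hn' : (0:ℝ) < n := by exact_mod_cast hn
  set M := ∑ u ∈ Finset.Icc 1 n, u * P u with hM
  have hMn : M ≤ n := h.2.2
  have hMr : (M:ℝ) = ∑ u ∈ Finset.Icc 1 n, (u:ℝ) * P u := by rw [hM]; push_cast; rfl
  have hkap : kappaTot n P = M / n := by
    unfold kappaTot
    rw [← Finset.sum_div, hMr]
  have hMn' : (M:ℝ) ≤ n := by exact_mod_cast hMn
  have hcast : ((n - M : ℕ) : ℝ) = n - M := by rw [Nat.cast_sub hMn]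
  have hnk : (n:ℝ) * (1 - kappaTot n P) = n - M := by rw [hkap]; field_simp
  -- (n-M) log (n-M)
  have hent : ((n:ℝ) - M) * Real.log ((n:ℝ) - M) =
      ((n:ℝ) - M) * L + ((n:ℝ) - M) * Real.log (1 - kappaTot n P) := by
    rcases eq_or_ne ((n:ℝ) - M) 0 with h0 | h0
    · rw [h0]; simp
    · have e : 1 - kappaTot n P = ((n:ℝ) - M) / n := by rw [hkap]; field_simp
      rw [e, Real.log_div h0 hn'.ne', hLdef]; ring
  -- E1
  have hnL : (1:ℝ) ≤ n * LL / L := by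
    have : n / L ≤ n * LL / L := by
      apply div_le_div_of_nonneg_right _ hL0.le; nlinarith
    linarith
  have hE : L + 1 ≤ n * LL / L := by
    have : n / L ≤ n * LL / L := by
      apply div_le_div_of_nonneg_right _ hL0.le; nlinarith
    linarith
  have E1 : |Real.log (n.factorial : ℝ) - Real.log ((n - M).factorial : ℝ) -
      (M * L - ((n:ℝ) - M) * Real.log (1 - kappaTot n P) - M)| ≤ 2 * (n * LL / L) := by
    have a1 := log_fact_lower n
    have a2 := log_fact_upper n
    have a3 := log_fact_lower (n - M)
    have a4 := log_fact_upper (n - M)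
    rw [hcast, hent] at a3 a4
    rw [← hLdef] at a1 a2
    have a5 : Real.log ((n:ℝ) - M) ≤ L := by
      rcases eq_or_ne ((n:ℝ) - M) 0 with h0 | h0
      · rw [h0, Real.log_zero]; exact hL0.le
      · rw [hLdef]
        apply Real.log_le_log
        · exact lt_of_le_of_ne (by linarith) h0.symm
        · have : (0:ℝ) ≤ M := Nat.cast_nonneg M
          linarith
    rw [abs_le]; constructor <;> linarith
  -- E2
  have hk : ∀ u ∈ Finset.Icc 1 n, (P u : ℝ) ≤ (u * P u) / (A * L) := by
    intro u _
    rcases eq_or_ne (P u) 0 with h0 | h0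
    · simp [h0]
    · rw [le_div_iff₀ (by positivity), mul_comm]
      exact mul_le_mul_of_nonneg_right (hsupp u h0).1 (Nat.cast_nonneg _)
  have hsumk : ∑ u ∈ Finset.Icc 1 n, (P u : ℝ) ≤ n / (A * L) := by
    calc _ ≤ ∑ u ∈ Finset.Icc 1 n, ((u:ℝ) * P u) / (A * L) := Finset.sum_le_sum hk
      _ = M / (A * L) := by rw [← Finset.sum_div, hMr]
      _ ≤ _ := by gcongr
  have E2 : |∑ u ∈ Finset.Icc 1 n, (P u : ℝ) * Real.log (u.factorial : ℝ) -
      ∑ u ∈ Finset.Icc 1 n, (P u : ℝ) * (u * Real.log u - u)| ≤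
        (|Real.log B| + 2) / A * (n * LL / L) := by
    rw [← Finset.sum_sub_distrib]
    refine (Finset.abs_sum_le_sum_abs _ _).trans ?_
    calc _ ≤ ∑ u ∈ Finset.Icc 1 n, (P u : ℝ) * ((|Real.log B| + 2) * LL) := by
          apply Finset.sum_le_sum
          intro u hu
          rw [← mul_sub, abs_mul, abs_of_nonneg (Nat.cast_nonneg (P u) : (0:ℝ) ≤ P u)]
          rcases eq_or_ne (P u) 0 with h0 | h0
          · simp [h0]
          · apply mul_le_mul_of_nonneg_left _ (Nat.cast_nonneg _)
            have hu0 : (0:ℝ) < u := by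
              rw [Finset.mem_Icc] at hu
              exact_mod_cast hu.1
            have b1 := log_fact_lower u
            have b2 := log_fact_upper u
            have b3 : Real.log u ≤ Real.log B + LL := by
              rw [hLL, ← Real.log_mul hB.ne' hL0.ne']
              exact Real.log_le_log hu0 (hsupp u h0).2
            have b4 := le_abs_self (Real.log B)
            have b5 := abs_nonneg (Real.log B)
            rw [abs_le]; constructor <;> nlinarith
      _ = (∑ u ∈ Finset.Icc 1 n, (P u : ℝ)) * ((|Real.log B| + 2) * LL) := by
          rw [Finset.sum_mul]
      _ ≤ n / (A * L) * ((|Real.log B| + 2) * LL) := by gcongr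
      _ = _ := by field_simp
  -- E3
  have hPn : ∀ u ∈ Finset.Icc 1 n, P u ≤ n := by
    intro u hu
    have h1 : u * P u ≤ M := Finset.single_le_sum (f := fun u => u * P u)
      (fun _ _ => Nat.zero_le _) hu
    rw [Finset.mem_Icc] at hu
    nlinarith
  have hcount : (((Finset.Icc 1 n).filter (fun u => P u ≠ 0)).card : ℝ) ≤ B * L := by
    have : (Finset.Icc 1 n).filter (fun u => P u ≠ 0) ⊆ Finset.Icc 1 ⌊B * L⌋₊ := by
      intro u hu
      rw [Finset.mem_filter, Finset.mem_Icc] at hu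
      rw [Finset.mem_Icc]
      exact ⟨hu.1.1, Nat.le_floor (hsupp u hu.2).2⟩
    have h2 := Finset.card_le_card this
    rw [Nat.card_Icc, Nat.add_sub_cancel] at h2
    calc _ ≤ ((⌊B * L⌋₊ : ℕ) : ℝ) := by exact_mod_cast h2
      _ ≤ _ := Nat.floor_le (by positivity)
  have E3 : |∑ u ∈ Finset.Icc 1 n, Real.log ((P u).factorial : ℝ) -
      ∑ u ∈ Finset.Icc 1 n, (P u : ℝ) * L| ≤ (3 / A + B) * (n * LL / L) := by
    rw [← Finset.sum_sub_distrib]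
    refine (Finset.abs_sum_le_sum_abs _ _).trans ?_
    calc _ ≤ ∑ u ∈ Finset.Icc 1 n, ((P u : ℝ) * (3 * LL) + if P u ≠ 0 then n / L ^ 2 else 0) := by
          apply Finset.sum_le_sum
          intro u hu
          rcases eq_or_ne (P u) 0 with h0 | h0
          · simp [h0]
          · rw [if_pos h0]
            set x : ℝ := (P u : ℝ) with hx
            have hx0 : 0 < x := by rw [hx]; exact_mod_cast Nat.pos_of_ne_zero h0
            have hxn : x ≤ n := by rw [hx]; exact_mod_cast hPn u hu
            have c1 := log_fact_lower (P u)
            rw [← hx] at c1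
            have c2 : Real.log ((P u).factorial : ℝ) ≤ x * L := by
              have : ((P u).factorial : ℝ) ≤ x ^ (P u) := by
                rw [hx]; exact_mod_cast Nat.factorial_le_pow (P u)
              calc _ ≤ Real.log (x ^ (P u)) := Real.log_le_log (by positivity) this
                _ = x * Real.log x := by rw [Real.log_pow]
                _ ≤ x * L := by
                  apply mul_le_mul_of_nonneg_left _ hx0.le
                  rw [hLdef]; exact Real.log_le_log hx0 hxn
            have c3 : L - Real.log x - 2 * LL ≤ n / (x * L ^ 2) := by
              have := Real.log_le_sub_one_of_pos (show 0 < n / (x * L ^ 2) by positivity)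
              rw [Real.log_div hn'.ne' (by positivity), Real.log_mul hx0.ne' (by positivity),
                Real.log_pow, ← hLdef, ← hLL] at this
              push_cast at this
              linarith
            have c4 : x * (L - Real.log x - 2 * LL) ≤ n / L ^ 2 := by
              calc _ ≤ x * (n / (x * L ^ 2)) := mul_le_mul_of_nonneg_left c3 hx0.le
                _ = _ := by field_simp
            have c5 : x ≤ x * LL := le_mul_of_one_le_right hx0.le hLL1
            rw [mul_sub, mul_sub] at c4
            rw [abs_le]; constructor
            · linarith
            · have : 0 ≤ x * (3 * LL) + n / L ^ 2 := by positivity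
              linarith
      _ = (∑ u ∈ Finset.Icc 1 n, (P u : ℝ)) * (3 * LL) +
          (((Finset.Icc 1 n).filter (fun u => P u ≠ 0)).card : ℝ) * (n / L ^ 2) := by
          rw [Finset.sum_add_distrib, Finset.sum_mul, ← Finset.sum_filter, Finset.sum_const,
            nsmul_eq_mul]
      _ ≤ n / (A * L) * (3 * LL) + (B * L) * (n / L ^ 2) := by gcongr
      _ = 3 / A * (n * LL / L) + B * (n * 1 / L) := by field_simp
      _ ≤ 3 / A * (n * LL / L) + B * (n * LL / L) := by gcongr
      _ = _ := by ring
  -- E4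
  have E4 : |∑ u ∈ Finset.Icc 1 n, (P u : ℝ) *
      (u * (Real.log (2 * L / c) - Real.log u - L / u + c / 2))| ≤
      (1 + c * B / 2 + c / 2) / A * D * (n * LL / L) := by
    refine (Finset.abs_sum_le_sum_abs _ _).trans ?_
    calc _ ≤ ∑ u ∈ Finset.Icc 1 n, (1 + c * B / 2 + c / 2) / (A * L) *
          (((u:ℝ) * P u) * |(u:ℝ) - 2 * L / c|) := by
          apply Finset.sum_le_sum
          intro u hu
          rw [abs_mul, abs_of_nonneg (Nat.cast_nonneg (P u) : (0:ℝ) ≤ P u)]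
          rcases eq_or_ne (P u) 0 with h0 | h0
          · simp [h0]
          · have hu0 : (0:ℝ) < u := by
              rw [Finset.mem_Icc] at hu
              exact_mod_cast hu.1
            have d1 := class_err hc hL0 hu0 (hsupp u h0).2
            calc _ ≤ ((u * P u) / (A * L)) * ((1 + c * B / 2 + c / 2) * |(u:ℝ) - 2 * L / c|) := by
                  apply mul_le_mul (hk u hu) d1 (abs_nonneg _) (by positivity)
              _ = _ := by ring
      _ = (1 + c * B / 2 + c / 2) / (A * L) *
          ∑ u ∈ Finset.Icc 1 n, (((u:ℝ) * P u) * |(u:ℝ) - 2 * L / c|) := by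
          rw [Finset.mul_sum]
      _ ≤ (1 + c * B / 2 + c / 2) / (A * L) * (D * LL * n) := by gcongr
      _ = _ := by field_simp
  -- combination
  have hFb : (Fb n P : ℝ) = ∑ u ∈ Finset.Icc 1 n, (P u : ℝ) * (u * (u - 1) / 2) := by
    unfold Fb
    push_cast
    apply Finset.sum_congr rfl
    intro u _
    rw [Nat.cast_choose_two]
  have comb : -∑ u ∈ Finset.Icc 1 n, (P u : ℝ) * (u * Real.log u - u) -
      ∑ u ∈ Finset.Icc 1 n, (P u : ℝ) * L - c * Fb n P + M * L - M -
      ∑ u ∈ Finset.Icc 1 n, ((u:ℝ) * P u) * (L - Real.log (2 * L / c) - c / 2 * u) =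
      ∑ u ∈ Finset.Icc 1 n, (P u : ℝ) *
      (u * (Real.log (2 * L / c) - Real.log u - L / u + c / 2)) := by
    rw [hFb, hMr, Finset.sum_mul, Finset.mul_sum, ← Finset.sum_neg_distrib]
    simp only [← Finset.sum_sub_distrib, ← Finset.sum_add_distrib]
    apply Finset.sum_congr rfl
    intro u hu
    have hu0 : (0:ℝ) < u := by
      rw [Finset.mem_Icc] at hu
      exact_mod_cast hu.1
    field_simp
    ring
  rw [(log_cnt h).2, ← hM, hnk]
  rw [← comb] at E4
  rw [abs_le] at E1 E2 E3 E4 ⊢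
  obtain ⟨e1, e1'⟩ := E1
  obtain ⟨e2, e2'⟩ := E2
  obtain ⟨e3, e3'⟩ := E3
  obtain ⟨e4, e4'⟩ := E4
  constructor <;> linarith

lemma phi_eq {p : ℝ} {n : ℕ} {P : ℕ → ℕ} {c L : ℝ} (hn : 0 < n)
    (hc : c = Real.log (1 / (1 - p))) (hc0 : 0 < c) (hL : L = Real.log n) (hL0 : 0 < L) :
    phiProfile p n P * n = -((n:ℝ) * (1 - kappaTot n P)) *
        Real.log (1 - kappaTot n P) + ∑ u ∈ Finset.Icc 1 n,
          ((u:ℝ) * P u) * (L - Real.log (2 * L / c) - c / 2 * u) := by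
  have hn' : (0:ℝ) < n := by exact_mod_cast hn
  unfold phiProfile alpha0 Real.logb
  rw [← hc, ← hL, add_mul, Finset.mul_sum, Finset.sum_mul]
  congr 1
  · ring
  · apply Finset.sum_congr rfl
    intro u _
    have h1 : Real.log (2 * L / c) = Real.log 2 + Real.log (L / c) := by
      rw [mul_div_assoc, Real.log_mul (by norm_num) (by positivity)]
    have h2 : Real.log (Real.exp 1 / 2) = 1 - Real.log 2 := by
      rw [Real.log_div (Real.exp_pos 1).ne' (by norm_num), Real.log_exp]
    rw [h1, h2]
    field_simp
    ring

lemma tendsto_logn : Tendsto (fun n : ℕ => Real.log (n:ℝ)) atTop atTop :=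
  Real.tendsto_log_atTop.comp tendsto_natCast_atTop_atTop

lemma ev_loglog_le (ε : ℝ) (hε : 0 < ε) :
    ∀ᶠ n : ℕ in atTop, Real.log (Real.log n) ≤ ε * Real.log n := by
  have h := Real.isLittleO_log_id_atTop.bound hε
  filter_upwards [tendsto_logn.eventually h, tendsto_logn.eventually_ge_atTop 0] with n h1 h2
  simp only [id, Real.norm_eq_abs] at h1
  rw [abs_of_nonneg h2] at h1
  exact (le_abs_self _).trans h1

lemma ev_logpow_le (k : ℕ) (ε : ℝ) (hε : 0 < ε) :
    ∀ᶠ n : ℕ in atTop, Real.log n ^ k ≤ ε * n := by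
  have h := (Real.isLittleO_pow_log_id_atTop (n := k)).bound hε
  filter_upwards [tendsto_natCast_atTop_atTop.eventually h] with n h1
  simp only [id, Real.norm_eq_abs] at h1
  rw [abs_of_nonneg (Nat.cast_nonneg n : (0:ℝ) ≤ n)] at h1
  exact (le_abs_self _).trans h1

lemma alpha_bounds (b c : ℝ) (hc : c = Real.log b) (hc0 : 0 < c) :
    ∃ D : ℝ, 0 < D ∧ ∀ᶠ n : ℕ in atTop,
      |(alphaNat b n : ℝ) - 2 * Real.log n / c| ≤ D * Real.log (Real.log n) ∧
      Real.log n / c ≤ alphaNat b n ∧ (alphaNat b n : ℝ) ≤ 3 * (Real.log n / c) := by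
  set D : ℝ := 2 / c + 2 * |Real.log c| / c + 2 * |Real.log (Real.exp 1 / 2)| / c + 2 with hD
  have hD0 : 0 < D := by positivity
  refine ⟨D, hD0, ?_⟩
  have hlim := tendsto_logn
  filter_upwards [hlim.eventually_ge_atTop 1,
    (Real.tendsto_log_atTop.comp hlim).eventually_ge_atTop 1,
    ev_loglog_le (1 / (c * D)) (by positivity)] with n hL hLL hsm
  simp only [Function.comp] at hLL
  set L := Real.log (n:ℝ) with hLdef
  set LL := Real.log L with hLLdef
  have hsm' : D * LL ≤ L / c := by
    calc D * LL ≤ D * (1 / (c * D) * L) := mul_le_mul_of_nonneg_left hsm hD0.le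
      _ = L / c := by field_simp
  have ha : alpha0 b n = 2 * L / c - 2 * (LL - Real.log c) / c +
      2 * Real.log (Real.exp 1 / 2) / c + 1 := by
    unfold alpha0 Real.logb
    rw [← hc, Real.log_div (by linarith) hc0.ne']
    ring
  have hb1 : |alpha0 b n - 2 * L / c| ≤ D * LL - 1 := by
    have e : alpha0 b n - 2 * L / c = (-(2 / c * LL) + 2 / c * Real.log c) +
        2 / c * Real.log (Real.exp 1 / 2) + 1 := by rw [ha]; ring
    have hc2 : 0 < 2 / c := by positivity
    have t1 := mul_le_mul_of_nonneg_left (le_abs_self (Real.log c)) hc2.le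
    have t2 := mul_le_mul_of_nonneg_left (neg_abs_le (Real.log c)) hc2.le
    have t3 := mul_le_mul_of_nonneg_left (le_abs_self (Real.log (Real.exp 1 / 2))) hc2.le
    have t4 := mul_le_mul_of_nonneg_left (neg_abs_le (Real.log (Real.exp 1 / 2))) hc2.le
    have s1 : 2 / c * |Real.log c| ≤ 2 / c * |Real.log c| * LL :=
      le_mul_of_one_le_right (by positivity) hLL
    have s2 : 2 / c * |Real.log (Real.exp 1 / 2)| ≤ 2 / c * |Real.log (Real.exp 1 / 2)| * LL :=
      le_mul_of_one_le_right (by positivity) hLL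
    have s3 : 0 ≤ 2 / c * LL := by positivity
    have e2 : D * LL = 2 / c * LL + 2 / c * |Real.log c| * LL +
        2 / c * |Real.log (Real.exp 1 / 2)| * LL + 2 * LL := by rw [hD]; ring
    rw [e, e2, abs_le]
    constructor <;> linarith
  have e3 : 2 * L / c = 2 * (L / c) := by ring
  have hLc : 0 < L / c := by positivity
  have hb2 := abs_le.1 hb1
  have hpos : 0 ≤ alpha0 b n := by linarith
  have f1 := Nat.floor_le hpos
  have f2 := Nat.lt_floor_add_one (alpha0 b n)
  have hb3 : |(alphaNat b n : ℝ) - 2 * L / c| ≤ D * LL := by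
    unfold alphaNat
    rw [abs_le]; constructor <;> linarith
  have hb4 := abs_le.1 hb3
  exact ⟨hb3, by linarith, by linarith⟩

lemma Fb_le {n : ℕ} {P : ℕ → ℕ} (h : IsProfile n (profileParts n P) P) {R : ℝ} (hR : 0 ≤ R)
    (hsupp : ∀ u, P u ≠ 0 → (u:ℝ) ≤ R) : (Fb n P : ℝ) ≤ R * n := by
  have hM : (∑ u ∈ Finset.Icc 1 n, (u:ℝ) * P u) ≤ n := by exact_mod_cast h.2.2
  unfold Fb
  push_cast
  calc _ ≤ ∑ u ∈ Finset.Icc 1 n, R * ((u:ℝ) * P u) := by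
        apply Finset.sum_le_sum
        intro u _
        rcases eq_or_ne (P u) 0 with h0 | h0
        · simp [h0]
        · rw [Nat.cast_choose_two]
          have h1 := hsupp u h0
          have h2 : (0:ℝ) ≤ u := Nat.cast_nonneg u
          have h3 : (0:ℝ) ≤ P u := Nat.cast_nonneg _
          have h4 : (u:ℝ) * (u - 1) / 2 ≤ R * u := by nlinarith
          calc _ ≤ (P u : ℝ) * (R * u) := mul_le_mul_of_nonneg_left h4 h3
            _ = _ := by ring
    _ = R * ∑ u ∈ Finset.Icc 1 n, ((u:ℝ) * P u) := by rw [Finset.mul_sum]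
    _ ≤ _ := mul_le_mul_of_nonneg_left hM hR

lemma mom_le {n : ℕ} {P : ℕ → ℕ} (h : IsProfile n (profileParts n P) P) (hn : 0 < n)
    {a x C E : ℝ} (hax : |a - x| ≤ E) (hE : 0 ≤ E)
    (hC : ∑ u ∈ Finset.Icc 1 n, ((u : ℝ) * P u / n) * (a - (u : ℝ)) ^ 2 ≤ C) :
    ∑ u ∈ Finset.Icc 1 n, ((u:ℝ) * P u) * |(u:ℝ) - x| ≤ (1 + C + E) * n := by
  have hn' : (0:ℝ) < n := by exact_mod_cast hn
  have hM : (∑ u ∈ Finset.Icc 1 n, (u:ℝ) * P u) ≤ n := by exact_mod_cast h.2.2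
  have hC' : ∑ u ∈ Finset.Icc 1 n, ((u : ℝ) * P u) * (a - (u : ℝ)) ^ 2 ≤ C * n := by
    have : ∑ u ∈ Finset.Icc 1 n, ((u : ℝ) * P u / n) * (a - (u : ℝ)) ^ 2 =
        (∑ u ∈ Finset.Icc 1 n, ((u : ℝ) * P u) * (a - (u : ℝ)) ^ 2) / n := by
      rw [Finset.sum_div]
      exact Finset.sum_congr rfl fun u _ => by ring
    rw [this, div_le_iff₀ hn'] at hC
    exact hC
  calc _ ≤ ∑ u ∈ Finset.Icc 1 n, (((u:ℝ) * P u) * (a - (u : ℝ)) ^ 2 +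
        ((u:ℝ) * P u) * (1 + E)) := by
        apply Finset.sum_le_sum
        intro u _
        rw [← mul_add]
        apply mul_le_mul_of_nonneg_left _ (by positivity)
        have h1 : |(u:ℝ) - x| ≤ |(u:ℝ) - a| + |a - x| := abs_sub_le _ _ _
        have h2 : |(u:ℝ) - a| ≤ (a - u) ^ 2 + 1 := by
          have : (a - u) ^ 2 = |(u:ℝ) - a| ^ 2 := by rw [sq_abs]; ring
          rw [this]
          nlinarith [sq_nonneg (|(u:ℝ) - a| - 1), abs_nonneg ((u:ℝ) - a)]
        linarith
    _ = ∑ u ∈ Finset.Icc 1 n, ((u:ℝ) * P u) * (a - (u : ℝ)) ^ 2 +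
        (∑ u ∈ Finset.Icc 1 n, (u:ℝ) * P u) * (1 + E) := by
        rw [Finset.sum_add_distrib, Finset.sum_mul]
    _ ≤ C * n + n * (1 + E) := by gcongr
    _ = _ := by ring

set_option maxHeartbeats 4000000 in
/-- Lemma 3.3: for profiles supported on `[0.1α, 10α]` with bounded second moment,
`E_m[X̄_κ]` and `E_p[X̄_κ]` equal `exp(φ(κ) n + O(n ln ln n / ln n))`. -/
theorem expectation_exponential_formula (p : ℝ) (hp : p ∈ Set.Ioo (0:ℝ) 1)
    (P : ℕ → ℕ → ℕ)
    (hprof : ∀ n, IsProfile n (profileParts n (P n)) (P n))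
    (hsupp : ∀ n, ∀ u : ℕ, ((u : ℝ) < 0.1 * (alphaNat (1/(1-p)) n : ℝ) ∨
        10 * (alphaNat (1/(1-p)) n : ℝ) < (u : ℝ)) → P n u = 0)
    (hmom : ∃ C : ℝ, ∀ n : ℕ, ∑ u ∈ Finset.Icc 1 n,
        ((u : ℝ) * P n u / n) * ((alphaNat (1/(1-p)) n : ℝ) - (u : ℝ)) ^ 2 ≤ C) :
    ∃ C : ℝ, 0 < C ∧ ∃ em ep : ℕ → ℝ,
      (∀ᶠ n : ℕ in atTop,
        |em n| ≤ C * n * Real.log (Real.log n) / Real.log n ∧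
        |ep n| ≤ C * n * Real.log (Real.log n) / Real.log n) ∧
      ∀ᶠ n : ℕ in atTop,
        Em n (mFloor p n) (fun G => Xbar G (P n)) =
          Real.exp (phiProfile p n (P n) * n + em n) ∧
        Ep n p (fun G => Xbar G (P n)) =
          Real.exp (phiProfile p n (P n) * n + ep n) := by
  obtain ⟨hp0, hp1⟩ := hp
  obtain ⟨C, hC⟩ := hmom
  set b : ℝ := 1 / (1 - p) with hb
  have hq : 0 < 1 - p := by linarith
  set c : ℝ := Real.log b with hc
  have hcq : c = -Real.log (1 - p) := by rw [hc, hb, one_div, Real.log_inv]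
  have hc0 : 0 < c := by
    rw [hcq]
    have := Real.log_neg hq (by linarith)
    linarith
  obtain ⟨D, hD0, hα⟩ := alpha_bounds b c hc hc0
  set A : ℝ := 0.1 / c with hA
  set B : ℝ := 30 / c with hB
  have hA0 : 0 < A := by positivity
  have hB0 : 0 < B := by positivity
  set D' : ℝ := 1 + |C| + D with hD'
  have hD'0 : 0 < D' := by positivity
  set K1 : ℝ := 2 + (|Real.log B| + 2) / A + (3 / A + B) + (1 + c * B / 2 + c / 2) / A * D' with hK1
  have hK10 : 0 < K1 := by positivity
  set K2 : ℝ := 32 * (B + 1) ^ 2 / (1 - p) with hK2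
  have hK20 : 0 < K2 := by positivity
  have hlim := tendsto_logn
  have main : ∀ᶠ n : ℕ in atTop,
      (0 < Em n (mFloor p n) (fun G => Xbar G (P n)) ∧
        |Real.log (Em n (mFloor p n) (fun G => Xbar G (P n))) - phiProfile p n (P n) * n| ≤
          (K1 + K2) * (n * Real.log (Real.log n) / Real.log n)) ∧
      (0 < Ep n p (fun G => Xbar G (P n)) ∧
        |Real.log (Ep n p (fun G => Xbar G (P n))) - phiProfile p n (P n) * n| ≤
          K1 * (n * Real.log (Real.log n) / Real.log n)) := by
    filter_upwards [hα, hlim.eventually_ge_atTop 1,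
      (Real.tendsto_log_atTop.comp hlim).eventually_ge_atTop 1,
      ev_logpow_le 2 (1/2) (by norm_num), ev_logpow_le 3 1 (by norm_num),
      ev_logpow_le 1 ((1 - p) / (32 * (B + 1))) (by positivity),
      eventually_ge_atTop 2] with n hαn hL hLL hs2 hs3 hs1 hn2
    simp only [Function.comp] at hLL
    obtain ⟨hα1, hα2, hα3⟩ := hαn
    have hprofn := hprof n
    have hsuppn := hsupp n
    have hCn := hC n
    have hn0 : 0 < n := by omega
    have hn' : (0:ℝ) < n := by exact_mod_cast hn0
    have hphi := phi_eq (P := P n) hn0 (hc.trans (by rw [hb])) hc0 rfl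
      (show 0 < Real.log (n:ℝ) by linarith)
    set L := Real.log (n:ℝ) with hLdef
    set LL := Real.log L with hLLdef
    have hL0 : 0 < L := by linarith
    have hsupp' : ∀ u, P n u ≠ 0 → A * L ≤ u ∧ (u:ℝ) ≤ B * L := by
      intro u hu
      have h1 : ¬ _ := fun hh => hu (hsuppn u hh)
      push Not at h1
      have eA : A * L = 0.1 * (L / c) := by rw [hA]; ring
      have eB : B * L = 30 * (L / c) := by rw [hB]; ring
      rw [eA, eB]
      constructor
      · linarith [h1.1]
      · linarith [h1.2]
    have hbig : L + 1 ≤ n / L := by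
      rw [le_div_iff₀ hL0]
      nlinarith
    have hmom' := mom_le hprofn hn0 hα1 (by positivity) hCn
    have hmom'' : ∑ u ∈ Finset.Icc 1 n, ((u:ℝ) * P n u) * |(u:ℝ) - 2 * L / c| ≤
        D' * LL * n := by
      refine hmom'.trans ?_
      apply mul_le_mul_of_nonneg_right _ hn'.le
      have h1 := le_abs_self C
      have h2 : 1 + |C| ≤ (1 + |C|) * LL := le_mul_of_one_le_right (by positivity) hLL
      rw [hD', add_mul]
      linarith
    have est := main_est hprofn hc0 hA0 hB0 hn0 hLdef hLLdef hL hLL hbig hsupp' hmom''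
    rw [← hphi, ← hK1] at est
    obtain ⟨hcnt, -⟩ := log_cnt hprofn
    have hqF : (0:ℝ) < (1 - p) ^ Fb n (P n) := by positivity
    refine ⟨?_, ?_⟩
    · -- the uniform model
      have hFle : (Fb n (P n) : ℝ) ≤ (B + 1) * L * n := by
        have := Fb_le hprofn (R := B * L) (by positivity) (fun u hu => (hsupp' u hu).2)
        nlinarith
      have hn2' : (2:ℝ) ≤ n := by exact_mod_cast hn2
      have hNr : ((n.choose 2 : ℕ) : ℝ) = n * (n - 1) / 2 := Nat.cast_choose_two ℝ n
      have hNge : (n:ℝ) ^ 2 / 4 ≤ (n.choose 2 : ℕ) := by rw [hNr]; nlinarith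
      have hN0 : 0 < n.choose 2 := Nat.choose_pos hn2
      have hN0' : (0:ℝ) < (n.choose 2 : ℕ) := by exact_mod_cast hN0
      have hpN : 0 ≤ p * (n.choose 2 : ℝ) := by positivity
      have m1 : (mFloor p n : ℝ) ≤ p * (n.choose 2 : ℝ) := Nat.floor_le hpN
      have m2 : p * (n.choose 2 : ℝ) < (mFloor p n : ℝ) + 1 := Nat.lt_floor_add_one _
      have h1F : 1 + (Fb n (P n) : ℝ) ≤ 2 * ((B + 1) * L * n) := by
        have : 1 ≤ (B + 1) * L * n := by
          have h1 : 1 ≤ (B + 1) * L := by nlinarith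
          nlinarith
        linarith
      have hs1' : 32 * (B + 1) * L ≤ (1 - p) * n := by
        rw [pow_one] at hs1
        calc _ ≤ 32 * (B + 1) * ((1 - p) / (32 * (B + 1)) * n) := by gcongr
          _ = _ := by field_simp
      have hF0 : 4 * (1 + (Fb n (P n) : ℝ)) ≤ (1 - p) * (n.choose 2 : ℕ) := by
        calc _ ≤ 4 * (2 * ((B + 1) * L * n)) := by linarith
          _ = (32 * (B + 1) * L) * (n / 4) := by ring
          _ ≤ ((1 - p) * n) * (n / 4) := by gcongr
          _ = (1 - p) * (n ^ 2 / 4) := by ring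
          _ ≤ _ := by gcongr
      obtain ⟨r1, r2⟩ := log_choose_ratio (n.choose 2) (mFloor p n) (1 - p) hq (by linarith) hN0
        (by linarith) (by linarith) (Fb n (P n)) hF0 (Fb n (P n)) le_rfl
      obtain ⟨r3, -⟩ := log_choose_ratio (n.choose 2) (mFloor p n) (1 - p) hq (by linarith) hN0
        (by linarith) (by linarith) (Fb n (P n)) hF0 0 (Nat.zero_le _)
      rw [Nat.sub_zero] at r3
      have r1' : (0:ℝ) < ((n.choose 2 - Fb n (P n)).choose (mFloor p n) : ℝ) := by
        exact_mod_cast r1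
      have r3' : (0:ℝ) < ((n.choose 2).choose (mFloor p n) : ℝ) := by exact_mod_cast r3
      have rerr : (Fb n (P n) : ℝ) * (4 * (1 + (Fb n (P n) : ℝ)) / ((1 - p) * (n.choose 2 : ℕ))) ≤
          K2 * (n * LL / L) := by
        calc _ ≤ ((B + 1) * L * n) * (4 * (2 * ((B + 1) * L * n)) / ((1 - p) * (n ^ 2 / 4))) := by
              gcongr
          _ = K2 * (L ^ 3 / L) := by rw [hK2]; field_simp; ring
          _ ≤ K2 * (n * LL / L) := by
              gcongr
              nlinarith
      rw [Em_eq _ hprofn]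
      refine ⟨by positivity, ?_⟩
      rw [Real.log_mul hcnt.ne' (by positivity), Real.log_div r1'.ne' r3'.ne']
      have r4 := r2.trans rerr
      rw [show Real.log (1 - p) = -c by rw [hcq]; ring] at r4
      rw [abs_le] at est r4 ⊢
      constructor <;> linarith [est.1, est.2, r4.1, r4.2]
    · rw [Ep_eq p hprofn]
      refine ⟨by positivity, ?_⟩
      rw [Real.log_mul hcnt.ne' hqF.ne', Real.log_pow,
        show Real.log (1 - p) = -c by rw [hcq]; ring]
      convert est using 2
      ring
  refine ⟨K1 + K2, by positivity,
    fun n => Real.log (Em n (mFloor p n) (fun G => Xbar G (P n))) - phiProfile p n (P n) * n,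
    fun n => Real.log (Ep n p (fun G => Xbar G (P n))) - phiProfile p n (P n) * n, ?_, ?_⟩
  · filter_upwards [main, hlim.eventually_ge_atTop 1,
      (Real.tendsto_log_atTop.comp hlim).eventually_ge_atTop 1] with n hmain hL hLL
    simp only [Function.comp] at hLL
    have e : (K1 + K2) * n * Real.log (Real.log n) / Real.log n =
        (K1 + K2) * (n * Real.log (Real.log n) / Real.log n) := by ring
    have hpos : 0 ≤ n * Real.log (Real.log n) / Real.log n := by positivity
    rw [e]
    refine ⟨hmain.1.2, hmain.2.2.trans ?_⟩
    nlinarith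
  · filter_upwards [main] with n hmain
    constructor
    · rw [add_sub_cancel, Real.exp_log hmain.1.1]
    · rw [add_sub_cancel, Real.exp_log hmain.2.1]
end
end
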